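/- arXiv:2303.00305 — 2 statements merged into one kernel-verified Lean document; each statement's English description precedes it below -/
import Mathlib

section
/- For every integer n ≥ 2, the graph Σ = Σ(H(n),X,Y) has exactly 2^{n²(n+1)/2 + n + 1} vertices and is locally 2-arc-transitive: for every vertex u of Σ, the stabiliser Aut(Σ)_u acts transitively on the set of 2-arcs (u,v,w) of Σ starting at u (equivalently, Aut(Σ)_u acts 2-transitively on the neighbourhood Σ(u)). -/
/-- The commutator `[g,h] = g⁻¹h⁻¹gh` (paper convention). -/
def gcomm {G : Type*} [Group G] (g h : G) : G := g⁻¹ * h⁻¹ * g * h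

/-- The generator index set for `H(n)`: `Sum.inl i` is `x_i`, `Sum.inr j` is `y_j`. -/
abbrev HGen (n : ℕ) := Fin n ⊕ Fin n

/-- The word `x_i` in the free group. -/
def xw {n : ℕ} (i : Fin n) : FreeGroup (HGen n) := FreeGroup.of (Sum.inl i)

/-- The word `y_j` in the free group. -/
def yw {n : ℕ} (j : Fin n) : FreeGroup (HGen n) := FreeGroup.of (Sum.inr j)

/-- The word `z` in the free group, for a generator `z`. -/
def zw {n : ℕ} (z : HGen n) : FreeGroup (HGen n) := FreeGroup.of z

/-- The relators of the presentation of `H(n)`. -/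
def HRels (n : ℕ) : Set (FreeGroup (HGen n)) :=
  {w | ∃ z, w = zw z ^ 2} ∪
  {w | ∃ i j, w = gcomm (xw i) (xw j)} ∪
  {w | ∃ i j, w = gcomm (yw i) (yw j)} ∪
  {w | ∃ i j, w = gcomm (xw i) (yw j) ^ 2} ∪
  {w | ∃ i j k, w = gcomm (gcomm (yw j) (xw i)) (yw k)} ∪
  {w | ∃ i j z, w = gcomm (gcomm (xw i) (yw j)) (zw z) ^ 2} ∪
  {w | ∃ z₁ z₂ z₃ z₄, w = gcomm (gcomm (gcomm (zw z₁) (zw z₂)) (zw z₃)) (zw z₄)}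

/-- The group `H(n)` defined by the presentation. -/
abbrev Hn (n : ℕ) := PresentedGroup (HRels n)

/-- The image of the generator `x_i` in `H(n)`. -/
def xH {n : ℕ} (i : Fin n) : Hn n := PresentedGroup.of (Sum.inl i)

/-- The image of the generator `y_j` in `H(n)`. -/
def yH {n : ℕ} (j : Fin n) : Hn n := PresentedGroup.of (Sum.inr j)

/-- The subgroup `X = ⟨x_1, …, x_n⟩` of `H(n)`. -/
def XH (n : ℕ) : Subgroup (Hn n) := Subgroup.closure (Set.range (xH (n := n)))

/-- The subgroup `Y = ⟨y_1, …, y_n⟩` of `H(n)`. -/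
def YH (n : ℕ) : Subgroup (Hn n) := Subgroup.closure (Set.range (yH (n := n)))

/-- The right coset `S·h` as a set. -/
def rcoset {G : Type*} [Group G] (S : Subgroup G) (h : G) : Set G := {g | ∃ s ∈ S, g = s * h}

/-- The vertex set of `Σ(H(n),X,Y)`: all right cosets of `X` and of `Y` in `H(n)`. -/
def SigmaV (n : ℕ) : Type :=
  {S : Set (Hn n) // (∃ h, S = rcoset (XH n) h) ∨ (∃ h, S = rcoset (YH n) h)}

/-- The graph `Σ(H(n),X,Y)`: `Xh` is adjacent to `Yg` iff `Xh ∩ Yg ≠ ∅`. -/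
def SigmaGraph (n : ℕ) : SimpleGraph (SigmaV n) where
  Adj u v := u ≠ v ∧ (u.val ∩ v.val).Nonempty ∧
    (((∃ h, u.val = rcoset (XH n) h) ∧ ∃ g, v.val = rcoset (YH n) g) ∨
     ((∃ h, v.val = rcoset (XH n) h) ∧ ∃ g, u.val = rcoset (YH n) g))
  symm := by
    constructor
    rintro u v ⟨hne, hint, hor⟩
    exact ⟨hne.symm, by rwa [Set.inter_comm], hor.symm⟩
  loopless := by constructor; rintro u ⟨hne, -⟩; exact hne rfl

open Function
open scoped commutatorElement

section General

variable {G : Type*} [Group G]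

theorem gcomm_eq_one_iff' {g h : G} : gcomm g h = 1 ↔ Commute g h := by
  unfold gcomm Commute SemiconjBy
  constructor
  · intro e
    calc g * h = h * g * (g⁻¹ * h⁻¹ * g * h) := by group
      _ = h * g := by rw [e, mul_one]
  · intro e
    calc g⁻¹ * h⁻¹ * g * h = g⁻¹ * h⁻¹ * (g * h) := by group
      _ = 1 := by rw [e]; group

theorem map_gcomm {K F : Type*} [Group K] [FunLike F G K] [MonoidHomClass F G K] (f : F) (g h : G) :
    f (gcomm g h) = gcomm (f g) (f h) := by
  simp [gcomm]

/-- An elementary abelian family gives a homomorphism. -/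
theorem exists_elemAb_hom {ι : Type*} [Fintype ι] [DecidableEq ι] (x : ι → G)
    (hc : ∀ i j, Commute (x i) (x j)) (hs : ∀ i, x i ^ 2 = 1) :
    ∃ ξ : Multiplicative (ι → ZMod 2) →* G,
      (∀ i, ξ (Multiplicative.ofAdd (Pi.single i 1)) = x i) ∧
      ξ.range = Subgroup.closure (Set.range x) := by
  have h1 : ∀ i, ∃ f : Multiplicative (ZMod 2) →* G, f (Multiplicative.ofAdd 1) = x i := by
    intro i
    let f0 : ℤ →+ Additive G := zmultiplesHom (Additive G) (Additive.ofMul (x i))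
    have hf0 : f0 2 = 0 := by
      have : (f0 2) = Additive.ofMul ((x i) ^ (2:ℤ)) := rfl
      rw [this]
      have := hs i
      simpa using by exact_mod_cast this
    refine ⟨AddMonoidHom.toMultiplicativeLeft (ZMod.lift 2 ⟨f0, by exact_mod_cast hf0⟩), ?_⟩
    have : (ZMod.lift 2 ⟨f0, by exact_mod_cast hf0⟩) ((1:ℤ) : ZMod 2) = f0 1 := ZMod.lift_coe _ _ _
    have e : f0 1 = Additive.ofMul (x i) := by simp [f0]
    rw [e] at this
    simp only [Int.cast_one] at this
    exact this
  choose f hf using h1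
  have hfx : ∀ i (z : Multiplicative (ZMod 2)), f i z = 1 ∨ f i z = x i := by
    intro i z
    have : ∀ z : ZMod 2, z = 0 ∨ z = 1 := by decide
    rcases this (Multiplicative.toAdd z) with h | h
    · left
      have : z = 1 := h
      rw [this, map_one]
    · right
      rw [← hf i, ← h]; rfl
  have hcm : Pairwise fun i j => ∀ (a b : Multiplicative (ZMod 2)), Commute (f i a) (f j b) := by
    intro i j _ a b
    rcases hfx i a with h | h
    · rw [h]; exact Commute.one_left _
    · rcases hfx j b with h' | h'
      · rw [h']; exact Commute.one_right _
      · rw [h, h']; exact hc i j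
  let Ψ := (MonoidHom.noncommPiCoprod f hcm)
  let e : Multiplicative (ι → ZMod 2) ≃* (ι → Multiplicative (ZMod 2)) :=
    MulEquiv.piMultiplicative _
  refine ⟨Ψ.comp e.toMonoidHom, ?_, ?_⟩
  · intro i
    have : e (Multiplicative.ofAdd (Pi.single i 1)) = Pi.mulSingle i (Multiplicative.ofAdd 1) := by
      ext j
      by_cases h : j = i
      · subst h; simp [e]
      · simp [e, h]
    simp only [MulEquiv.toMonoidHom_eq_coe, MonoidHom.coe_comp, MonoidHom.coe_coe, comp_apply]
    rw [this]
    simp only [Ψ, MonoidHom.noncommPiCoprod_mulSingle, hf]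
  · have : (Ψ.comp e.toMonoidHom).range = Ψ.range := by
      rw [MonoidHom.range_comp, MonoidHom.range_eq_top.2 e.surjective, ← MonoidHom.range_eq_map]
    rw [this, MonoidHom.noncommPiCoprod_range]
    apply le_antisymm
    · rw [iSup_le_iff]
      rintro i _ ⟨z, rfl⟩
      rcases hfx i z with h | h <;> rw [h]
      · exact one_mem _
      · exact Subgroup.subset_closure ⟨i, rfl⟩
    · rw [Subgroup.closure_le]
      rintro _ ⟨i, rfl⟩
      exact (le_iSup (fun i => (f i).range) i) ⟨_, hf i⟩

theorem elemAb_hom_ext {ι : Type*} [Fintype ι] [DecidableEq ι]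
    {f g : Multiplicative (ι → ZMod 2) →* G}
    (h : ∀ i, f (Multiplicative.ofAdd (Pi.single i 1)) = g (Multiplicative.ofAdd (Pi.single i 1))) :
    f = g := by
  have key : ∀ v : ι → ZMod 2, ∀ H : Subgroup (Multiplicative (ι → ZMod 2)),
      (∀ i, Multiplicative.ofAdd (Pi.single i 1) ∈ H) → Multiplicative.ofAdd v ∈ H := by
    intro v H hH
    have : v ∈ Subgroup.toAddSubgroup' H := by
      apply AddSubgroup.pi_mem_of_single_mem
      intro i
      have h2 : ∀ z : ZMod 2, z = 0 ∨ z = 1 := by decide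
      rcases h2 (v i) with h | h <;> rw [h]
      · simp
      · exact hH i
    exact this
  refine MonoidHom.ext fun v => ?_
  exact key (Multiplicative.toAdd v) (f.eqLocus g) h

end General

section HnFacts

variable {n : ℕ}

/-- Image of a generator. -/
abbrev zH (z : HGen n) : Hn n := PresentedGroup.of z

theorem hrel {w : FreeGroup (HGen n)} (hw : w ∈ HRels n) : PresentedGroup.mk (HRels n) w = 1 :=
  PresentedGroup.one_of_mem hw

theorem mk_gcomm (a b : FreeGroup (HGen n)) : PresentedGroup.mk (HRels n) (gcomm a b) =
    gcomm (PresentedGroup.mk (HRels n) a) (PresentedGroup.mk (HRels n) b) := map_gcomm _ _ _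

theorem z_sq (z : HGen n) : zH z ^ 2 = 1 := by
  have := hrel (n := n) (w := zw z ^ 2)
    (Or.inl <| Or.inl <| Or.inl <| Or.inl <| Or.inl <| Or.inl ⟨z, rfl⟩)
  rwa [map_pow] at this

theorem x_comm (i j : Fin n) : Commute (xH i) (xH j) := by
  have := hrel (n := n) (w := gcomm (xw i) (xw j))
    (Or.inl <| Or.inl <| Or.inl <| Or.inl <| Or.inl <| Or.inr ⟨i, j, rfl⟩)
  rwa [mk_gcomm, gcomm_eq_one_iff'] at this

theorem y_comm (i j : Fin n) : Commute (yH i) (yH j) := by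
  have := hrel (n := n) (w := gcomm (yw i) (yw j))
    (Or.inl <| Or.inl <| Or.inl <| Or.inl <| Or.inr ⟨i, j, rfl⟩)
  rwa [mk_gcomm, gcomm_eq_one_iff'] at this

theorem c_sq (i j : Fin n) : gcomm (xH i) (yH j) ^ 2 = 1 := by
  have := hrel (n := n) (w := gcomm (xw i) (yw j) ^ 2)
    (Or.inl <| Or.inl <| Or.inl <| Or.inr ⟨i, j, rfl⟩)
  rwa [map_pow, mk_gcomm] at this

theorem c_y (i j k : Fin n) : Commute (gcomm (xH i) (yH j)) (yH k) := by
  have := hrel (n := n) (w := gcomm (gcomm (yw j) (xw i)) (yw k))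
    (Or.inl <| Or.inl <| Or.inr ⟨i, j, k, rfl⟩)
  rw [mk_gcomm, gcomm_eq_one_iff', mk_gcomm] at this
  have h2 : gcomm (xH i) (yH j) = (gcomm (yH j) (xH i))⁻¹ := by simp [gcomm, mul_assoc]
  rw [h2]
  exact Commute.inv_left this

theorem d_sq (i j : Fin n) (z : HGen n) : gcomm (gcomm (xH i) (yH j)) (zH z) ^ 2 = 1 := by
  have := hrel (n := n) (w := gcomm (gcomm (xw i) (yw j)) (zw z) ^ 2)
    (Or.inl <| Or.inr ⟨i, j, z, rfl⟩)
  rwa [map_pow, mk_gcomm, mk_gcomm] at this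

theorem w4 (z₁ z₂ z₃ z₄ : HGen n) :
    gcomm (gcomm (gcomm (zH z₁) (zH z₂)) (zH z₃)) (zH z₄) = 1 := by
  have := hrel (n := n) (w := gcomm (gcomm (gcomm (zw z₁) (zw z₂)) (zw z₃)) (zw z₄))
    (Or.inr ⟨z₁, z₂, z₃, z₄, rfl⟩)
  rwa [mk_gcomm, mk_gcomm, mk_gcomm] at this

/-- `mod N`-version of commuting with generators. -/
theorem gcomm_mem_iff {G : Type*} [Group G] {N : Subgroup G} [N.Normal] {g h : G} :
    gcomm g h ∈ N ↔ Commute (QuotientGroup.mk' N g) (QuotientGroup.mk' N h) := by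
  rw [← gcomm_eq_one_iff', ← map_gcomm, QuotientGroup.mk'_apply, QuotientGroup.eq_one_iff]

theorem gcomm_right_mem {N : Subgroup (Hn n)} [N.Normal] {g : Hn n}
    (h : ∀ z, gcomm g (zH z) ∈ N) (k : Hn n) : gcomm g k ∈ N := by
  rw [gcomm_mem_iff]
  let K : Subgroup (Hn n) :=
    (Subgroup.centralizer {QuotientGroup.mk' N g}).comap (QuotientGroup.mk' N)
  have : k ∈ K := PresentedGroup.generated_by _ K (fun z => by
    rw [Subgroup.mem_comap, Subgroup.mem_centralizer_singleton_iff]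
    exact (gcomm_mem_iff.1 (h z)).symm) k
  rw [Subgroup.mem_comap, Subgroup.mem_centralizer_singleton_iff] at this
  exact Commute.symm this

theorem gcomm_left_mem {N : Subgroup (Hn n)} [N.Normal] {g : Hn n}
    (h : ∀ z, gcomm (zH z) g ∈ N) (k : Hn n) : gcomm k g ∈ N := by
  rw [gcomm_mem_iff]
  let K : Subgroup (Hn n) :=
    (Subgroup.centralizer {QuotientGroup.mk' N g}).comap (QuotientGroup.mk' N)
  have : k ∈ K := PresentedGroup.generated_by _ K (fun z => by
    rw [Subgroup.mem_comap, Subgroup.mem_centralizer_singleton_iff]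
    exact (gcomm_mem_iff.1 (h z))) k
  rw [Subgroup.mem_comap, Subgroup.mem_centralizer_singleton_iff] at this
  exact this

theorem d_cen (z₁ z₂ z₃ : HGen n) :
    gcomm (gcomm (zH z₁) (zH z₂)) (zH z₃) ∈ Subgroup.center (Hn n) := by
  rw [Subgroup.mem_center_iff]
  intro g
  have := gcomm_right_mem (N := ⊥) (g := gcomm (gcomm (zH z₁) (zH z₂)) (zH z₃))
    (fun z => by rw [Subgroup.mem_bot]; exact w4 _ _ _ _) g
  rw [Subgroup.mem_bot, gcomm_eq_one_iff'] at this
  exact this.symm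

theorem step_iff {G : Type*} [Group G] {N : Subgroup G} [N.Normal] {g : G} :
    g ∈ Subgroup.upperCentralSeriesStep N ↔ ∀ h, gcomm g h ∈ N := by
  rw [Subgroup.mem_upperCentralSeriesStep]
  have : ∀ h, ⁅g, h⁆ ∈ N ↔ gcomm g h ∈ N := by
    intro h
    rw [gcomm_mem_iff, ← commutatorElement_eq_one_iff_commute, ← map_commutatorElement,
      QuotientGroup.mk'_apply, QuotientGroup.eq_one_iff]
  simp only [this]

theorem class3 (a b c d : Hn n) : gcomm (gcomm (gcomm a b) c) d = 1 := by
  let N1 := Subgroup.center (Hn n)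
  let N2 := Subgroup.upperCentralSeriesStep N1
  let N3 := Subgroup.upperCentralSeriesStep N2
  have h2 : ∀ z₁ z₂, gcomm (zH z₁) (zH z₂) ∈ N2 := fun z₁ z₂ =>
    step_iff.2 (gcomm_right_mem (fun z => d_cen _ _ _))
  have h3 : ∀ z, zH z ∈ N3 := fun z => step_iff.2 (gcomm_right_mem (h2 z))
  have ha : a ∈ N3 := PresentedGroup.generated_by _ N3 h3 a
  have := step_iff.1 (step_iff.1 ha b) c
  rw [gcomm_eq_one_iff']
  exact ((Subgroup.mem_center_iff.1 this) d).symm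

theorem z_mul (z : HGen n) : zH z * zH z = 1 := by rw [← pow_two, z_sq]
theorem x_mul (i : Fin n) : xH i * xH i = 1 := z_mul _
theorem y_mul (i : Fin n) : yH i * yH i = 1 := z_mul _
theorem x_inv (i : Fin n) : (xH i)⁻¹ = xH i := inv_eq_of_mul_eq_one_left (x_mul i)
theorem y_inv (i : Fin n) : (yH i)⁻¹ = yH i := inv_eq_of_mul_eq_one_left (y_mul i)

/-- The commutators. -/
def cH (i j : Fin n) : Hn n := gcomm (xH i) (yH j)
/-- The double commutators. -/
def dH (j i k : Fin n) : Hn n := gcomm (cH i j) (xH k)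

theorem c_mul (i j : Fin n) : cH i j * cH i j = 1 := by rw [← pow_two]; exact c_sq i j
theorem d_mul (j i k : Fin n) : dH j i k * dH j i k = 1 := by
  rw [← pow_two]; exact d_sq i j (Sum.inl k)
theorem d_comm (j i k : Fin n) (g : Hn n) : Commute (dH j i k) g :=
  ((Subgroup.mem_center_iff.1 (d_cen (Sum.inl i) (Sum.inr j) (Sum.inl k))) g).symm

/-- conj of y by x -/
theorem y_conj (i j : Fin n) : xH i * yH j * xH i = yH j * cH i j := by
  have h := c_mul i j
  have : cH i j = yH j * xH i * yH j * xH i := by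
    rw [← inv_eq_of_mul_eq_one_left h]
    simp [cH, gcomm, x_inv, y_inv, mul_assoc]
  rw [this]
  simp only [← mul_assoc, y_mul, one_mul]

theorem c_conj (i j k : Fin n) : xH k * cH i j * xH k = cH i j * dH j i k := by
  simp only [dH, gcomm, x_inv]
  group

theorem c_comm (i j k l : Fin n) : Commute (cH i j) (cH k l) := by
  have h1 : cH i j * xH k = xH k * cH i j * dH j i k := by
    calc cH i j * xH k = (xH k * xH k) * cH i j * xH k := by rw [x_mul, one_mul]
      _ = xH k * (xH k * cH i j * xH k) := by group
      _ = _ := by rw [c_conj]; group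
  have h2 : cH i j * yH l = yH l * cH i j := c_y i j l
  have h3 : cH k l = xH k * yH l * xH k * yH l := by simp [cH, gcomm, x_inv, y_inv]
  have hd := fun g => (d_comm j i k g).eq
  have hd2 := d_mul j i k
  generalize cH i j = C at *
  generalize dH j i k = D at *
  rw [h3]
  change C * _ = _ * C
  calc C * (xH k * yH l * xH k * yH l) = (C * xH k) * (yH l * xH k * yH l) := by group
    _ = xH k * C * (D * (yH l * xH k * yH l)) := by rw [h1]; group
    _ = xH k * (C * yH l) * xH k * yH l * D := by rw [hd]; group
    _ = xH k * yH l * (C * xH k) * yH l * D := by rw [h2]; group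
    _ = xH k * yH l * xH k * C * (D * yH l) * D := by rw [h1]; group
    _ = xH k * yH l * xH k * (C * yH l) * (D * D) := by rw [hd]; group
    _ = _ := by rw [h2, hd2]; group

theorem y_conj2 (i j k : Fin n) : xH k * (xH i * yH j * xH i) * xH k =
    yH j * (cH k j * cH i j) * dH j i k := by
  rw [y_conj]
  calc xH k * (yH j * cH i j) * xH k = xH k * yH j * (xH k * xH k) * cH i j * xH k := by
        rw [x_mul]; group
    _ = (xH k * yH j * xH k) * (xH k * cH i j * xH k) := by group
    _ = _ := by rw [y_conj, c_conj]; group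

theorem d_symm (j i k : Fin n) : dH j i k = dH j k i := by
  have h1 := y_conj2 i j k
  have h2 := y_conj2 k j i
  have e : xH k * (xH i * yH j * xH i) * xH k = xH i * (xH k * yH j * xH k) * xH i := by
    have := (x_comm i k).eq
    calc _ = (xH k * xH i) * yH j * (xH i * xH k) := by group
      _ = (xH i * xH k) * yH j * (xH k * xH i) := by rw [this]
      _ = _ := by group
  rw [h1, h2, (c_comm k j i j).eq] at e
  exact mul_left_cancel e

theorem d_self (j i : Fin n) : dH j i i = 1 := by
  have h1 := y_conj2 i j i
  rw [c_mul, mul_one] at h1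
  have : xH i * (xH i * yH j * xH i) * xH i = yH j * 1 := by
    calc _ = (xH i * xH i) * yH j * (xH i * xH i) := by group
      _ = _ := by rw [x_mul]; group
  rw [this] at h1
  exact (mul_left_cancel h1).symm

/-- Ordered pairs `i < k`. -/
abbrev PIdx (n : ℕ) := Σ k : Fin n, Fin k.val

/-- second component as element of `Fin n`. -/
def PIdx.lo (p : PIdx n) : Fin n := ⟨p.2.val, p.2.isLt.trans p.1.isLt⟩

/-- Index set of generators of the normal closure of `Y`. -/
abbrev TIdx (n : ℕ) := Fin n ⊕ (Fin n × Fin n) ⊕ (Fin n × PIdx n)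

/-- generators of `T`. -/
def tgen : TIdx n → Hn n
  | Sum.inl j => yH j
  | Sum.inr (Sum.inl p) => cH p.1 p.2
  | Sum.inr (Sum.inr p) => dH p.1 p.2.1 p.2.lo

theorem tgen_comm (a b : TIdx n) : Commute (tgen a) (tgen b) := by
  rcases a with j | ⟨i, j⟩ | ⟨j, p⟩ <;> rcases b with j' | ⟨i', j'⟩ | ⟨j', p'⟩
  · exact y_comm _ _
  · exact (c_y _ _ _).symm
  · exact (d_comm _ _ _ _).symm
  · exact (c_y _ _ _)
  · exact c_comm _ _ _ _
  · exact (d_comm _ _ _ _).symm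
  all_goals exact (d_comm _ _ _ _)

theorem tgen_sq (a : TIdx n) : tgen a ^ 2 = 1 := by
  rcases a with j | ⟨i, j⟩ | ⟨j, p⟩
  · exact z_sq _
  · exact c_sq _ _
  · exact d_sq _ _ (Sum.inl _)

variable (n) in
/-- The normal closure of `Y`. -/
def TH : Subgroup (Hn n) := Subgroup.closure (Set.range (tgen (n := n)))

theorem y_mem_T (j : Fin n) : yH j ∈ TH n := Subgroup.subset_closure ⟨Sum.inl j, rfl⟩
theorem c_mem_T (i j : Fin n) : cH i j ∈ TH n := Subgroup.subset_closure ⟨Sum.inr (Sum.inl (i,j)), rfl⟩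
theorem d_mem_T (j i k : Fin n) : dH j i k ∈ TH n := by
  rcases lt_trichotomy i k with h | h | h
  · rw [d_symm]
    exact Subgroup.subset_closure ⟨Sum.inr (Sum.inr (j, ⟨k, ⟨i.val, h⟩⟩)), rfl⟩
  · subst h; rw [d_self]; exact one_mem _
  · exact Subgroup.subset_closure ⟨Sum.inr (Sum.inr (j, ⟨i, ⟨k.val, h⟩⟩)), rfl⟩

theorem exists_T_hom : ∃ τ : Multiplicative (TIdx n → ZMod 2) →* Hn n, τ.range = TH n := by
  obtain ⟨τ, -, h⟩ := exists_elemAb_hom (tgen (n := n)) tgen_comm tgen_sq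
  exact ⟨τ, h⟩

theorem T_comm {a b : Hn n} (ha : a ∈ TH n) (hb : b ∈ TH n) : Commute a b := by
  obtain ⟨τ, h⟩ := exists_T_hom (n := n)
  rw [← h] at ha hb
  obtain ⟨a, rfl⟩ := ha
  obtain ⟨b, rfl⟩ := hb
  change _ * _ = _ * _
  rw [← map_mul, ← map_mul, mul_comm]

theorem T_sq {a : Hn n} (ha : a ∈ TH n) : a ^ 2 = 1 := by
  obtain ⟨τ, h⟩ := exists_T_hom (n := n)
  rw [← h] at ha
  obtain ⟨a, rfl⟩ := ha
  rw [← map_pow]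
  have : a ^ 2 = 1 := by
    apply Multiplicative.toAdd.injective
    rw [toAdd_pow, toAdd_one]
    ext i
    have : ∀ z : ZMod 2, 2 • z = 0 := by decide
    exact this _
  rw [this, map_one]

theorem T_conj_z (z : HGen n) {t : Hn n} (ht : t ∈ TH n) : zH z * t * (zH z)⁻¹ ∈ TH n := by
  rcases z with k | k
  · change xH k * t * (xH k)⁻¹ ∈ TH n
    unfold TH at ht
    induction ht using Subgroup.closure_induction with
    | one => simp
    | mul a b _ _ ha hb =>
      have := mul_mem ha hb
      convert this using 1; group
    | inv a _ ha =>
      have := inv_mem ha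
      convert this using 1; group
    | mem t ht =>
      obtain ⟨a, rfl⟩ := ht
      rw [x_inv]
      rcases a with j | ⟨i, j⟩ | ⟨j, p⟩
      · change xH k * yH j * xH k ∈ _
        rw [y_conj]; exact mul_mem (y_mem_T _) (c_mem_T _ _)
      · change xH k * cH i j * xH k ∈ _
        rw [c_conj]; exact mul_mem (c_mem_T _ _) (d_mem_T _ _ _)
      · change xH k * dH j p.1 p.lo * xH k ∈ _
        rw [← (d_comm _ _ _ _).eq, mul_assoc, x_mul, mul_one]; exact d_mem_T _ _ _
  · rw [(T_comm (y_mem_T k) ht : _ * _ = _ * _ )|> fun h => (h : zH (Sum.inr k) * t = t * yH k)]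
    change t * yH k * (yH k)⁻¹ ∈ _
    simpa using ht

instance T_normal : (TH n).Normal := by
  have : ∀ g : Hn n, g ∈ Subgroup.normalizer (TH n : Set (Hn n)) := by
    apply PresentedGroup.generated_by
    intro z
    rw [Subgroup.mem_normalizer_iff]
    intro h
    refine ⟨T_conj_z z, fun hh => ?_⟩
    have := T_conj_z z hh
    have e : zH z * (zH z * h * (zH z)⁻¹) * (zH z)⁻¹ = h := by
      have := z_mul z
      calc _ = (zH z * zH z) * h * (zH z * zH z)⁻¹ := by group
        _ = h := by rw [this]; group
    rwa [e] at this
  exact ⟨fun t ht g => (Subgroup.mem_normalizer_iff.1 (this g) t).1 ht⟩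

theorem Y_le_T : YH n ≤ TH n := by
  rw [YH, Subgroup.closure_le]
  rintro _ ⟨j, rfl⟩
  exact y_mem_T j

theorem gcomm_mem_T_left {a b : Hn n} (hb : b ∈ TH n) : gcomm a b ∈ TH n := by
  have := mul_mem (T_normal.conj_mem _ (inv_mem hb) a⁻¹) hb
  convert this using 1
  simp [gcomm, mul_assoc]

theorem gcomm_mem_T_right {a b : Hn n} (hb : a ∈ TH n) : gcomm a b ∈ TH n := by
  have := mul_mem (inv_mem hb) (T_normal.conj_mem _ hb b⁻¹)
  convert this using 1
  simp [gcomm, mul_assoc]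

end HnFacts

section Homs

variable {n : ℕ}

/-- Homomorphisms out of `H(n)`. -/
theorem exists_hom {K : Type*} [Group K] (a b : Fin n → K)
    (ha : ∀ i, a i ^ 2 = 1) (hb : ∀ i, b i ^ 2 = 1)
    (haa : ∀ i j, Commute (a i) (a j)) (hbb : ∀ i j, Commute (b i) (b j))
    (hc : ∀ i j, gcomm (a i) (b j) ^ 2 = 1)
    (hcb : ∀ i j k, gcomm (gcomm (b j) (a i)) (b k) = 1)
    (hd : ∀ i j, ∀ g : K, gcomm (gcomm (a i) (b j)) g ^ 2 = 1)
    (h4 : ∀ g₁ g₂ g₃ g₄ : K, gcomm (gcomm (gcomm g₁ g₂) g₃) g₄ = 1) :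
    ∃ f : Hn n →* K, (∀ i, f (xH i) = a i) ∧ (∀ j, f (yH j) = b j) := by
  let f0 : HGen n → K := Sum.elim a b
  have hx : ∀ i, FreeGroup.lift f0 (xw i) = a i := fun i => by simp [xw, f0]
  have hy : ∀ i, FreeGroup.lift f0 (yw i) = b i := fun i => by simp [yw, f0]
  have H : ∀ r ∈ HRels n, FreeGroup.lift f0 r = 1 := by
    rintro r ((((((⟨z, rfl⟩ | ⟨i, j, rfl⟩) | ⟨i, j, rfl⟩) | ⟨i, j, rfl⟩) | ⟨i, j, k, rfl⟩) |
      ⟨i, j, z, rfl⟩) | ⟨z₁, z₂, z₃, z₄, rfl⟩)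
    · rw [map_pow]
      rcases z with i | i
      · exact (congrArg (· ^ 2) (hx i)).trans (ha i)
      · exact (congrArg (· ^ 2) (hy i)).trans (hb i)
    · rw [map_gcomm, hx, hx]; exact gcomm_eq_one_iff'.2 (haa i j)
    · rw [map_gcomm, hy, hy]; exact gcomm_eq_one_iff'.2 (hbb i j)
    · rw [map_pow, map_gcomm, hx, hy]; exact hc i j
    · rw [map_gcomm, map_gcomm, hx, hy, hy]; exact hcb i j k
    · rw [map_pow, map_gcomm, map_gcomm, hx, hy]; exact hd i j _
    · rw [map_gcomm, map_gcomm, map_gcomm]; exact h4 _ _ _ _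
  exact ⟨PresentedGroup.toGroup H, fun i => PresentedGroup.toGroup.of H,
    fun i => PresentedGroup.toGroup.of H⟩

theorem hom_ext' {K : Type*} [Group K] {f g : Hn n →* K} (hx : ∀ i, f (xH i) = g (xH i))
    (hy : ∀ i, f (yH i) = g (yH i)) : f = g := by
  apply PresentedGroup.ext
  rintro (i | i)
  · exact hx i
  · exact hy i

theorem exists_X_hom : ∃ ξ : Multiplicative (Fin n → ZMod 2) →* Hn n,
    (∀ i, ξ (Multiplicative.ofAdd (Pi.single i 1)) = xH i) ∧ ξ.range = XH n :=
  exists_elemAb_hom _ x_comm (fun _ => z_sq _)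

theorem exists_Y_hom : ∃ ξ : Multiplicative (Fin n → ZMod 2) →* Hn n,
    (∀ i, ξ (Multiplicative.ofAdd (Pi.single i 1)) = yH i) ∧ ξ.range = YH n :=
  exists_elemAb_hom _ y_comm (fun _ => z_sq _)

theorem range_comm {ι K : Type*} [Group K] {ξ : Multiplicative (ι → ZMod 2) →* K} {a b : K}
    (ha : a ∈ ξ.range) (hb : b ∈ ξ.range) : Commute a b := by
  obtain ⟨a, rfl⟩ := ha
  obtain ⟨b, rfl⟩ := hb
  change _ * _ = _ * _
  rw [← map_mul, ← map_mul, mul_comm]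

theorem range_sq {ι K : Type*} [Group K] {ξ : Multiplicative (ι → ZMod 2) →* K} {a : K}
    (ha : a ∈ ξ.range) : a ^ 2 = 1 := by
  obtain ⟨a, rfl⟩ := ha
  rw [← map_pow]
  have : a ^ 2 = 1 := by
    apply Multiplicative.toAdd.injective
    rw [toAdd_pow, toAdd_one]
    ext i
    have : ∀ z : ZMod 2, 2 • z = 0 := by decide
    exact this _
  rw [this, map_one]

/-- Endomorphisms of `H(n)`. -/
theorem exists_endo (a b : Fin n → Hn n) (ha : ∀ i, a i ∈ XH n) (hb : ∀ i, b i ∈ YH n) :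
    ∃ f : Hn n →* Hn n, (∀ i, f (xH i) = a i) ∧ (∀ j, f (yH j) = b j) := by
  obtain ⟨ξ, -, hξ⟩ := exists_X_hom (n := n)
  have hbT : ∀ i, b i ∈ TH n := fun i => Y_le_T (hb i)
  apply exists_hom
  · intro i; exact range_sq (ξ := ξ) (hξ ▸ ha i)
  · intro i; exact T_sq (hbT i)
  · intro i j; exact range_comm (ξ := ξ) (hξ ▸ ha i) (hξ ▸ ha j)
  · intro i j; exact T_comm (hbT i) (hbT j)
  · intro i j; exact T_sq (gcomm_mem_T_left (hbT j))
  · intro i j k; rw [gcomm_eq_one_iff']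
    exact T_comm (gcomm_mem_T_right (hbT j)) (hbT k)
  · intro i j g; exact T_sq (gcomm_mem_T_right (gcomm_mem_T_left (hbT j)))
  · exact class3

theorem zmod2 (z : ZMod 2) : z = 0 ∨ z = 1 := by revert z; decide

/-- An involution of `F_2^n` taking `v` to `w`. -/
theorem exists_invol {v w : Fin n → ZMod 2} (hv : v ≠ 0) (hw : w ≠ 0) :
    ∃ A : (Fin n → ZMod 2) →+ (Fin n → ZMod 2), (∀ u, A (A u) = u) ∧ A v = w := by
  have hG : ∃ g : (Fin n → ZMod 2) →+ ZMod 2, g v = 1 ∧ g w = 1 := by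
    obtain ⟨i, hi⟩ := Function.ne_iff.1 hv
    obtain ⟨j, hj⟩ := Function.ne_iff.1 hw
    have hi' := (zmod2 (v i)).resolve_left hi
    have hj' := (zmod2 (w j)).resolve_left hj
    rcases zmod2 (w i) with h1 | h1
    · rcases zmod2 (v j) with h2 | h2
      · exact ⟨Pi.evalAddMonoidHom (fun _ => ZMod 2) i + Pi.evalAddMonoidHom (fun _ => ZMod 2) j, by
          change v i + v j = 1; rw [hi', h2, add_zero],
          by
          change w i + w j = 1; rw [hj', h1, zero_add]⟩
      · exact ⟨Pi.evalAddMonoidHom _ j, h2, hj'⟩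
    · exact ⟨Pi.evalAddMonoidHom _ i, hi', h1⟩
  obtain ⟨g, gv, gw⟩ := hG
  have hd : ∀ u : Fin n → ZMod 2, u + u = 0 := by
    intro u; ext i
    have : ∀ z : ZMod 2, z + z = 0 := by decide
    exact this _
  refine ⟨⟨⟨fun u => u + g u • (v + w), by simp⟩, ?_⟩, ?_, ?_⟩
  · intro a b
    simp only [map_add, add_smul]
    abel
  · intro u
    change (u + g u • (v + w)) + g (u + g u • (v + w)) • (v + w) = u
    have h0 : g (g u • (v + w)) = 0 := by
      rcases zmod2 (g u) with h | h <;> rw [h]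
      · simp
      · rw [one_smul, map_add, gv, gw]; decide
    rw [map_add, h0, add_zero, add_assoc, hd, add_zero]
  · change v + g v • (v + w) = w
    rw [gv, one_smul, ← add_assoc, hd, zero_add]

theorem exists_auto (A B : (Fin n → ZMod 2) →+ (Fin n → ZMod 2))
    (hA : ∀ u, A (A u) = u) (hB : ∀ u, B (B u) = u)
    (ξ η : Multiplicative (Fin n → ZMod 2) →* Hn n)
    (hξ : ∀ i, ξ (Multiplicative.ofAdd (Pi.single i 1)) = xH i) (hξr : ξ.range = XH n)
    (hη : ∀ i, η (Multiplicative.ofAdd (Pi.single i 1)) = yH i) (hηr : η.range = YH n) :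
    ∃ φ : Hn n ≃* Hn n, (∀ u, φ (ξ (.ofAdd u)) = ξ (.ofAdd (A u))) ∧
      (∀ u, φ (η (.ofAdd u)) = η (.ofAdd (B u))) ∧
      (∀ g, φ g ∈ XH n ↔ g ∈ XH n) ∧ (∀ g, φ g ∈ YH n ↔ g ∈ YH n) := by
  obtain ⟨f, fx, fy⟩ := exists_endo (fun i => ξ (.ofAdd (A (Pi.single i 1))))
    (fun i => η (.ofAdd (B (Pi.single i 1)))) (fun i => hξr ▸ ⟨_, rfl⟩) (fun i => hηr ▸ ⟨_, rfl⟩)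
  have e1 : f.comp ξ = ξ.comp (AddMonoidHom.toMultiplicative A) := elemAb_hom_ext (fun i => by
    change f (ξ _) = ξ (.ofAdd (A (Pi.single i 1)))
    rw [hξ, fx])
  have e2 : f.comp η = η.comp (AddMonoidHom.toMultiplicative B) := elemAb_hom_ext (fun i => by
    change f (η _) = η (.ofAdd (B (Pi.single i 1)))
    rw [hη, fy])
  have e1' : ∀ u, f (ξ (.ofAdd u)) = ξ (.ofAdd (A u)) := fun u => DFunLike.congr_fun e1 (.ofAdd u)
  have e2' : ∀ u, f (η (.ofAdd u)) = η (.ofAdd (B u)) := fun u => DFunLike.congr_fun e2 (.ofAdd u)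
  have ff : f.comp f = MonoidHom.id _ := hom_ext'
    (fun i => by
      change f (f _) = xH i
      rw [fx, e1', hA, hξ])
    (fun i => by
      change f (f _) = yH i
      rw [fy, e2', hB, hη])
  have ff' : ∀ g, f (f g) = g := fun g => DFunLike.congr_fun ff g
  have mX : ∀ g ∈ XH n, f g ∈ XH n := by
    intro g hg
    rw [← hξr] at hg ⊢
    obtain ⟨u, rfl⟩ := hg
    exact ⟨_, (e1' u).symm⟩
  have mY : ∀ g ∈ YH n, f g ∈ YH n := by
    intro g hg
    rw [← hηr] at hg ⊢
    obtain ⟨u, rfl⟩ := hg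
    exact ⟨_, (e2' u).symm⟩
  refine ⟨MonoidHom.toMulEquiv f f ff ff, e1', e2', ?_, ?_⟩
  · intro g
    exact ⟨fun h => by simpa [ff'] using mX _ h, mX g⟩
  · intro g
    exact ⟨fun h => by simpa [ff'] using mY _ h, mY g⟩

theorem auto_Y {y y' : Hn n} (hy : y ∈ YH n) (hy' : y' ∈ YH n) (h1 : y ≠ 1) (h1' : y' ≠ 1) :
    ∃ φ : Hn n ≃* Hn n, φ y = y' ∧
      (∀ g, φ g ∈ XH n ↔ g ∈ XH n) ∧ (∀ g, φ g ∈ YH n ↔ g ∈ YH n) := by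
  obtain ⟨ξ, hξ, hξr⟩ := exists_X_hom (n := n)
  obtain ⟨η, hη, hηr⟩ := exists_Y_hom (n := n)
  rw [← hηr] at hy hy'
  obtain ⟨v, rfl⟩ := hy
  obtain ⟨w, rfl⟩ := hy'
  have hv : Multiplicative.toAdd v ≠ 0 := fun h => h1 (by
    have : v = 1 := h
    rw [this, map_one])
  have hw : Multiplicative.toAdd w ≠ 0 := fun h => h1' (by
    have : w = 1 := h
    rw [this, map_one])
  obtain ⟨B, hB, hvw⟩ := exists_invol hv hw
  obtain ⟨φ, -, h2, h3, h4⟩ := exists_auto (AddMonoidHom.id _) B (fun _ => rfl) hB ξ η hξ hξr hη hηr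
  exact ⟨φ, (h2 (Multiplicative.toAdd v)).trans (by rw [hvw]; rfl), h3, h4⟩

theorem auto_X {y y' : Hn n} (hy : y ∈ XH n) (hy' : y' ∈ XH n) (h1 : y ≠ 1) (h1' : y' ≠ 1) :
    ∃ φ : Hn n ≃* Hn n, φ y = y' ∧
      (∀ g, φ g ∈ XH n ↔ g ∈ XH n) ∧ (∀ g, φ g ∈ YH n ↔ g ∈ YH n) := by
  obtain ⟨ξ, hξ, hξr⟩ := exists_X_hom (n := n)
  obtain ⟨η, hη, hηr⟩ := exists_Y_hom (n := n)
  rw [← hξr] at hy hy'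
  obtain ⟨v, rfl⟩ := hy
  obtain ⟨w, rfl⟩ := hy'
  have hv : Multiplicative.toAdd v ≠ 0 := fun h => h1 (by
    have : v = 1 := h
    rw [this, map_one])
  have hw : Multiplicative.toAdd w ≠ 0 := fun h => h1' (by
    have : w = 1 := h
    rw [this, map_one])
  obtain ⟨B, hB, hvw⟩ := exists_invol hv hw
  obtain ⟨φ, h2, -, h3, h4⟩ := exists_auto B (AddMonoidHom.id _) hB (fun _ => rfl) ξ η hξ hξr hη hηr
  exact ⟨φ, (h2 (Multiplicative.toAdd v)).trans (by rw [hvw]; rfl), h3, h4⟩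

/-- Projection to the `X`-part of the abelianisation. -/
theorem exists_projX : ∃ f : Hn n →* Multiplicative (Fin n → ZMod 2),
    (∀ i, f (xH i) = .ofAdd (Pi.single i 1)) ∧ (∀ j, f (yH j) = 1) := by
  have hone : ∀ g h : Multiplicative (Fin n → ZMod 2), gcomm g h = 1 := fun g h =>
    gcomm_eq_one_iff'.2 (Commute.all _ _)
  have hsq : ∀ g : Multiplicative (Fin n → ZMod 2), g ^ 2 = 1 := fun g =>
    range_sq (ξ := MonoidHom.id _) ⟨g, rfl⟩
  exact exists_hom _ _ (fun _ => hsq _) (fun _ => hsq _) (fun _ _ => Commute.all _ _)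
    (fun _ _ => Commute.all _ _) (fun _ _ => hsq _) (fun _ _ _ => hone _ _) (fun _ _ _ => hsq _)
    (fun _ _ _ _ => hone _ _)

theorem exists_projY : ∃ f : Hn n →* Multiplicative (Fin n → ZMod 2),
    (∀ i, f (xH i) = 1) ∧ (∀ j, f (yH j) = .ofAdd (Pi.single j 1)) := by
  have hone : ∀ g h : Multiplicative (Fin n → ZMod 2), gcomm g h = 1 := fun g h =>
    gcomm_eq_one_iff'.2 (Commute.all _ _)
  have hsq : ∀ g : Multiplicative (Fin n → ZMod 2), g ^ 2 = 1 := fun g =>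
    range_sq (ξ := MonoidHom.id _) ⟨g, rfl⟩
  exact exists_hom _ _ (fun _ => hsq _) (fun _ => hsq _) (fun _ _ => Commute.all _ _)
    (fun _ _ => Commute.all _ _) (fun _ _ => hsq _) (fun _ _ _ => hone _ _) (fun _ _ _ => hsq _)
    (fun _ _ _ _ => hone _ _)

theorem card_range_of_leftInv {ι K : Type*} [Fintype ι] [DecidableEq ι] [Group K]
    (ξ : Multiplicative (ι → ZMod 2) →* K) (f : K →* Multiplicative (ι → ZMod 2))
    (h : ∀ i, f (ξ (.ofAdd (Pi.single i 1))) = .ofAdd (Pi.single i 1)) :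
    Nat.card ξ.range = 2 ^ Fintype.card ι := by
  have e : f.comp ξ = MonoidHom.id _ := elemAb_hom_ext h
  have inj : Injective ξ := fun a b hab => by
    have := congrArg f hab
    have h1 := DFunLike.congr_fun e a
    have h2 := DFunLike.congr_fun e b
    simp only [MonoidHom.comp_apply, MonoidHom.id_apply] at h1 h2
    rwa [h1, h2] at this
  rw [← Nat.card_congr (MonoidHom.ofInjective inj).toEquiv]
  have : Nat.card (Multiplicative (ι → ZMod 2)) = Nat.card (ι → ZMod 2) := rfl
  rw [this, Nat.card_eq_fintype_card, Fintype.card_fun, ZMod.card]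

theorem card_X : Nat.card (XH n) = 2 ^ n := by
  obtain ⟨ξ, hξ, hξr⟩ := exists_X_hom (n := n)
  obtain ⟨f, fx, -⟩ := exists_projX (n := n)
  rw [← hξr, card_range_of_leftInv ξ f (fun i => by rw [hξ, fx]), Fintype.card_fin]

theorem card_Y : Nat.card (YH n) = 2 ^ n := by
  obtain ⟨ξ, hξ, hξr⟩ := exists_Y_hom (n := n)
  obtain ⟨f, -, fx⟩ := exists_projY (n := n)
  rw [← hξr, card_range_of_leftInv ξ f (fun i => by rw [hξ, fx]), Fintype.card_fin]

theorem X_ne_Y (hn : 0 < n) : XH n ≠ YH n := by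
  intro h
  obtain ⟨f, fx, fy⟩ := exists_projX (n := n)
  have h1 : YH n ≤ f.ker := by
    rw [YH, Subgroup.closure_le]
    rintro _ ⟨j, rfl⟩
    exact fy j
  have h2 : xH (⟨0, hn⟩ : Fin n) ∈ f.ker := h1 (h ▸ Subgroup.subset_closure ⟨_, rfl⟩)
  rw [MonoidHom.mem_ker, fx] at h2
  have : (Pi.single (⟨0, hn⟩ : Fin n) (1 : ZMod 2) : Fin n → ZMod 2) = 0 := h2
  have := congrFun this ⟨0, hn⟩
  simp at this

end Homs

section GraphPart

variable {n : ℕ}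

theorem mem_rcoset {G : Type*} [Group G] {S : Subgroup G} {g h : G} :
    g ∈ rcoset S h ↔ g * h⁻¹ ∈ S := by
  constructor
  · rintro ⟨s, hs, rfl⟩; simpa using hs
  · intro hs; exact ⟨_, hs, by simp⟩

theorem self_mem_rcoset {G : Type*} [Group G] (S : Subgroup G) (h : G) : h ∈ rcoset S h :=
  mem_rcoset.2 (by simp)

theorem rcoset_eq_of_mem {G : Type*} [Group G] {S : Subgroup G} {g h : G}
    (hg : g ∈ rcoset S h) : rcoset S h = rcoset S g := by
  ext k
  rw [mem_rcoset] at hg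
  rw [mem_rcoset, mem_rcoset]
  have : k * h⁻¹ = (k * g⁻¹) * (g * h⁻¹) := by group
  rw [this]
  exact Subgroup.mul_mem_cancel_right _ hg

theorem subgroup_eq_of_rcoset_eq {G : Type*} [Group G] {S T : Subgroup G} {g h : G}
    (e : rcoset S g = rcoset T h) : S = T := by
  have h1 : rcoset T h = rcoset T g := rcoset_eq_of_mem (e ▸ self_mem_rcoset S g)
  rw [h1] at e
  ext k
  have : k * g ∈ rcoset S g ↔ k * g ∈ rcoset T g := by rw [e]
  simpa [mem_rcoset] using this

theorem image_rcoset_mulEquiv {G : Type*} [Group G] {S : Subgroup G} (φ : G ≃* G)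
    (hφ : ∀ g, φ g ∈ S ↔ g ∈ S) (a b h : G) :
    (fun g => φ (g * a) * b) '' rcoset S h = rcoset S (φ (h * a) * b) := by
  ext k
  constructor
  · rintro ⟨g, hg, rfl⟩
    rw [mem_rcoset] at hg ⊢
    have : φ (g * a) * b * (φ (h * a) * b)⁻¹ = φ (g * h⁻¹) := by
      simp
    rwa [this, hφ]
  · intro hk
    refine ⟨φ.symm (k * b⁻¹) * a⁻¹, ?_, by simp⟩
    rw [mem_rcoset] at hk ⊢
    rw [← hφ]
    have : φ (φ.symm (k * b⁻¹) * a⁻¹ * h⁻¹) = k * (φ (h * a) * b)⁻¹ := by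
      simp [mul_assoc]
    rwa [this]

/-- Graph automorphism from a coset preserving permutation. -/
def graphAut (e : Hn n ≃ Hn n)
    (hX : ∀ h, e '' rcoset (XH n) h = rcoset (XH n) (e h))
    (hY : ∀ h, e '' rcoset (YH n) h = rcoset (YH n) (e h)) :
    SigmaGraph n ≃g SigmaGraph n :=
  have hX' : ∀ h, e.symm '' rcoset (XH n) h = rcoset (XH n) (e.symm h) := fun h => by
    have := hX (e.symm h)
    rw [Equiv.apply_symm_apply] at this
    rw [← this, Equiv.symm_image_image]
  have hY' : ∀ h, e.symm '' rcoset (YH n) h = rcoset (YH n) (e.symm h) := fun h => by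
    have := hY (e.symm h)
    rw [Equiv.apply_symm_apply] at this
    rw [← this, Equiv.symm_image_image]
  have key : ∀ (e : Hn n ≃ Hn n) (_ : ∀ h, e '' rcoset (XH n) h = rcoset (XH n) (e h))
    (_ : ∀ h, e '' rcoset (YH n) h = rcoset (YH n) (e h)) (u v : Set (Hn n)),
      (u ≠ v ∧ (u ∩ v).Nonempty ∧
    (((∃ h, u = rcoset (XH n) h) ∧ ∃ g, v = rcoset (YH n) g) ∨
     ((∃ h, v = rcoset (XH n) h) ∧ ∃ g, u = rcoset (YH n) g))) →
      (e '' u ≠ e '' v ∧ (e '' u ∩ e '' v).Nonempty ∧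
    (((∃ h, e '' u = rcoset (XH n) h) ∧ ∃ g, e '' v = rcoset (YH n) g) ∨
     ((∃ h, e '' v = rcoset (XH n) h) ∧ ∃ g, e '' u = rcoset (YH n) g))) := by
    rintro e hX hY u v ⟨h1, h2, h3⟩
    refine ⟨fun h => h1 (e.injective.image_injective h), ?_, ?_⟩
    · rw [← Set.image_inter e.injective]; exact h2.image _
    · rcases h3 with ⟨⟨h, rfl⟩, ⟨g, rfl⟩⟩ | ⟨⟨h, rfl⟩, ⟨g, rfl⟩⟩
      · exact Or.inl ⟨⟨_, hX h⟩, ⟨_, hY g⟩⟩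
      · exact Or.inr ⟨⟨_, hX h⟩, ⟨_, hY g⟩⟩
  { toFun := fun u => ⟨e '' u.val, by
      rcases u.property with ⟨h, hh⟩ | ⟨h, hh⟩
      · exact Or.inl ⟨_, by rw [hh, hX]⟩
      · exact Or.inr ⟨_, by rw [hh, hY]⟩⟩
    invFun := fun u => ⟨e.symm '' u.val, by
      rcases u.property with ⟨h, hh⟩ | ⟨h, hh⟩
      · exact Or.inl ⟨_, by rw [hh, hX']⟩
      · exact Or.inr ⟨_, by rw [hh, hY']⟩⟩
    left_inv := fun u => Subtype.ext (by simp)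
    right_inv := fun u => Subtype.ext (by simp)
    map_rel_iff' := by
      intro u v
      constructor
      · rintro ⟨h1, h2, h3⟩
        have := key e.symm hX' hY' (e '' u.val) (e '' v.val)
          ⟨fun h => h1 (Subtype.ext h), h2, h3⟩
        simp only [Equiv.symm_image_image] at this
        exact ⟨fun h => this.1 (congrArg Subtype.val h), this.2⟩
      · rintro ⟨h1, h2, h3⟩
        have := key e hX hY u.val v.val ⟨fun h => h1 (Subtype.ext h), h2, h3⟩
        exact ⟨fun h => this.1 (congrArg Subtype.val h), this.2⟩ }

/-- The permutation `g ↦ φ(g a) b`. -/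
def affEquiv (φ : Hn n ≃* Hn n) (a b : Hn n) : Hn n ≃ Hn n :=
  ((Equiv.mulRight a).trans φ.toEquiv).trans (Equiv.mulRight b)

theorem exists_graphAut (φ : Hn n ≃* Hn n) (hX : ∀ g, φ g ∈ XH n ↔ g ∈ XH n)
    (hY : ∀ g, φ g ∈ YH n ↔ g ∈ YH n) (a b : Hn n) :
    ∃ F : SigmaGraph n ≃g SigmaGraph n,
      (∀ (u : SigmaV n) h, u.val = rcoset (XH n) h →
        (F u).val = rcoset (XH n) (φ (h * a) * b)) ∧
      (∀ (u : SigmaV n) h, u.val = rcoset (YH n) h →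
        (F u).val = rcoset (YH n) (φ (h * a) * b)) := by
  refine ⟨graphAut (affEquiv φ a b) (image_rcoset_mulEquiv φ hX a b)
    (image_rcoset_mulEquiv φ hY a b), ?_, ?_⟩
  · intro u h hu
    change (affEquiv φ a b) '' u.val = _
    rw [hu]; exact image_rcoset_mulEquiv φ hX a b h
  · intro u h hu
    change (affEquiv φ a b) '' u.val = _
    rw [hu]; exact image_rcoset_mulEquiv φ hY a b h

theorem adj_of_X (hn : 0 < n) {u v : SigmaV n} (h : (SigmaGraph n).Adj u v)
    (hu : ∃ g, u.val = rcoset (XH n) g) :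
    ∃ g, u.val = rcoset (XH n) g ∧ v.val = rcoset (YH n) g := by
  obtain ⟨-, ⟨k, hku, hkv⟩, h⟩ := h
  obtain ⟨g, hg⟩ := hu
  rcases h with ⟨⟨a, ha⟩, ⟨b, hb⟩⟩ | ⟨-, ⟨b, hb⟩⟩
  · refine ⟨k, ?_, ?_⟩
    · rw [ha] at hku ⊢; exact rcoset_eq_of_mem hku
    · rw [hb] at hkv ⊢; exact rcoset_eq_of_mem hkv
  · exact absurd (subgroup_eq_of_rcoset_eq (hg.symm.trans hb)) (X_ne_Y hn)

theorem adj_of_Y (hn : 0 < n) {u v : SigmaV n} (h : (SigmaGraph n).Adj u v)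
    (hu : ∃ g, u.val = rcoset (YH n) g) :
    ∃ g, u.val = rcoset (YH n) g ∧ v.val = rcoset (XH n) g := by
  obtain ⟨-, ⟨k, hku, hkv⟩, h⟩ := h
  obtain ⟨g, hg⟩ := hu
  rcases h with ⟨⟨a, ha⟩, ⟨b, hb⟩⟩ | ⟨⟨a, ha⟩, ⟨b, hb⟩⟩
  · exact absurd (subgroup_eq_of_rcoset_eq (ha.symm.trans hg)) (X_ne_Y hn)
  · refine ⟨k, ?_, ?_⟩
    · rw [hb] at hku ⊢; exact rcoset_eq_of_mem hku
    · rw [ha] at hkv ⊢; exact rcoset_eq_of_mem hkv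

theorem arc_of_X (hn : 0 < n) {u v w : SigmaV n} (h : (SigmaGraph n).Adj u v)
    (h' : (SigmaGraph n).Adj v w) (huw : u ≠ w) (hu : ∃ g, u.val = rcoset (XH n) g) :
    ∃ g, ∃ y ∈ YH n, y ≠ 1 ∧ u.val = rcoset (XH n) g ∧ v.val = rcoset (YH n) g ∧
      w.val = rcoset (XH n) (y * g) := by
  obtain ⟨g, hg1, hg2⟩ := adj_of_X hn h hu
  obtain ⟨k, hk1, hk2⟩ := adj_of_Y hn h' ⟨g, hg2⟩
  have : k ∈ rcoset (YH n) g := by rw [← hg2, hk1]; exact self_mem_rcoset _ _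
  obtain ⟨y, hy, rfl⟩ := this
  refine ⟨g, y, hy, ?_, hg1, hg2, hk2⟩
  rintro rfl
  rw [one_mul] at hk2
  exact huw (Subtype.ext (hg1.trans hk2.symm))

theorem arc_of_Y (hn : 0 < n) {u v w : SigmaV n} (h : (SigmaGraph n).Adj u v)
    (h' : (SigmaGraph n).Adj v w) (huw : u ≠ w) (hu : ∃ g, u.val = rcoset (YH n) g) :
    ∃ g, ∃ y ∈ XH n, y ≠ 1 ∧ u.val = rcoset (YH n) g ∧ v.val = rcoset (XH n) g ∧
      w.val = rcoset (YH n) (y * g) := by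
  obtain ⟨g, hg1, hg2⟩ := adj_of_Y hn h hu
  obtain ⟨k, hk1, hk2⟩ := adj_of_X hn h' ⟨g, hg2⟩
  have : k ∈ rcoset (XH n) g := by rw [← hg2, hk1]; exact self_mem_rcoset _ _
  obtain ⟨y, hy, rfl⟩ := this
  refine ⟨g, y, hy, ?_, hg1, hg2, hk2⟩
  rintro rfl
  rw [one_mul] at hk2
  exact huw (Subtype.ext (hg1.trans hk2.symm))

theorem local_trans (hn : 0 < n) (u v w v' w' : SigmaV n)
    (h1 : (SigmaGraph n).Adj u v) (h2 : (SigmaGraph n).Adj v w) (h3 : u ≠ w)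
    (h4 : (SigmaGraph n).Adj u v') (h5 : (SigmaGraph n).Adj v' w') (h6 : u ≠ w') :
    ∃ φ : SigmaGraph n ≃g SigmaGraph n, φ u = u ∧ φ v = v' ∧ φ w = w' := by
  rcases u.property with hu | hu
  · obtain ⟨g, y, hy, hy1, e1, e2, e3⟩ := arc_of_X hn h1 h2 h3 hu
    obtain ⟨g', y', hy', hy1', e1', e2', e3'⟩ := arc_of_X hn h4 h5 h6 hu
    obtain ⟨φ, hφ, hX, hY⟩ := auto_Y hy hy' hy1 hy1'
    obtain ⟨F, FX, FY⟩ := exists_graphAut φ hX hY g⁻¹ g'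
    refine ⟨F, Subtype.ext ?_, Subtype.ext ?_, Subtype.ext ?_⟩
    · rw [FX u g e1, e1']; simp
    · rw [FY v g e2, e2']; simp
    · rw [FX w _ e3, e3']; simp [hφ]
  · obtain ⟨g, y, hy, hy1, e1, e2, e3⟩ := arc_of_Y hn h1 h2 h3 hu
    obtain ⟨g', y', hy', hy1', e1', e2', e3'⟩ := arc_of_Y hn h4 h5 h6 hu
    obtain ⟨φ, hφ, hX, hY⟩ := auto_X hy hy' hy1 hy1'
    obtain ⟨F, FX, FY⟩ := exists_graphAut φ hX hY g⁻¹ g'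
    refine ⟨F, Subtype.ext ?_, Subtype.ext ?_, Subtype.ext ?_⟩
    · rw [FY u g e1, e1']; simp
    · rw [FX v g e2, e2']; simp
    · rw [FY w _ e3, e3']; simp [hφ]

theorem card_rcosets {G : Type*} [Group G] (S : Subgroup G) :
    Nat.card {A : Set G // ∃ h, A = rcoset S h} = S.index := by
  have e : {A : Set G // ∃ h, A = rcoset S h} ≃ Quotient (QuotientGroup.rightRel S) := by
    symm
    refine Equiv.ofBijective (fun q => Quotient.lift
      (fun h => (⟨rcoset S h, h, rfl⟩ : {A : Set G // ∃ h, A = rcoset S h})) ?_ q) ⟨?_, ?_⟩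
    · intro a b hab
      apply Subtype.ext
      apply rcoset_eq_of_mem
      rw [mem_rcoset]
      exact QuotientGroup.rightRel_apply.1 hab
    · intro p q
      induction p using Quotient.inductionOn
      induction q using Quotient.inductionOn
      rename_i a b
      intro h
      apply Quotient.sound
      have h' : rcoset S a = rcoset S b := congrArg Subtype.val h
      apply QuotientGroup.rightRel_apply.2
      rw [← mem_rcoset, h']
      exact self_mem_rcoset _ _
    · rintro ⟨A, h, rfl⟩
      exact ⟨Quotient.mk _ h, rfl⟩
  rw [Nat.card_congr e, Nat.card_congr (QuotientGroup.quotientRightRelEquivQuotientLeftRel S)]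
  rfl

theorem card_V (hn : 0 < n) [Finite (Hn n)] :
    Nat.card (SigmaV n) = (XH n).index + (YH n).index := by
  classical
  rw [← card_rcosets, ← card_rcosets, ← Nat.card_sum]
  apply Nat.card_congr
  apply Equiv.symm
  refine (Equiv.ofBijective (fun s => Sum.elim (fun A => ⟨A.val, Or.inl A.property⟩)
    (fun A => ⟨A.val, Or.inr A.property⟩) s) ⟨?_, ?_⟩)
  · rintro (⟨A, a, rfl⟩ | ⟨A, a, rfl⟩) (⟨B, b, rfl⟩ | ⟨B, b, rfl⟩) h <;>
      have h' := congrArg Subtype.val h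
    · exact congrArg Sum.inl (Subtype.ext h')
    · exact absurd (subgroup_eq_of_rcoset_eq h') (X_ne_Y hn)
    · exact absurd (subgroup_eq_of_rcoset_eq h'.symm) (X_ne_Y hn)
    · exact congrArg Sum.inr (Subtype.ext h')
  · rintro ⟨A, h | h⟩
    · exact ⟨Sum.inl ⟨A, h⟩, rfl⟩
    · exact ⟨Sum.inr ⟨A, h⟩, rfl⟩

end GraphPart

section Model

/-- Concrete model of `H(n)`. -/
@[ext]
structure Mdl (n : ℕ) where
  v : Fin n → ZMod 2
  a : Fin n → ZMod 2
  b : Fin n × Fin n → ZMod 2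
  c : Fin n × PIdx n → ZMod 2

namespace Mdl

variable {n : ℕ}

instance : Mul (Mdl n) := ⟨fun g h => ⟨g.v + h.v, g.a + h.a,
  fun p => g.b p + g.a p.2 * h.v p.1 + h.b p,
  fun q => g.c q + g.b (q.2.1, q.1) * h.v q.2.lo + g.b (q.2.lo, q.1) * h.v q.2.1 +
    g.a q.1 * h.v q.2.1 * h.v q.2.lo + h.c q⟩⟩

instance : One (Mdl n) := ⟨⟨0, 0, 0, 0⟩⟩

instance : Inv (Mdl n) := ⟨fun g => ⟨-g.v, -g.a,
  fun p => -g.b p + g.a p.2 * g.v p.1,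
  fun q => -g.c q + g.b (q.2.1, q.1) * g.v q.2.lo + g.b (q.2.lo, q.1) * g.v q.2.1 -
    g.a q.1 * g.v q.2.1 * g.v q.2.lo⟩⟩

@[simp] theorem one_v : (1 : Mdl n).v = 0 := rfl
@[simp] theorem one_a : (1 : Mdl n).a = 0 := rfl
@[simp] theorem one_b : (1 : Mdl n).b = 0 := rfl
@[simp] theorem one_c : (1 : Mdl n).c = 0 := rfl
@[simp] theorem mul_v (g h : Mdl n) : (g * h).v = g.v + h.v := rfl
@[simp] theorem mul_a (g h : Mdl n) : (g * h).a = g.a + h.a := rfl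
@[simp] theorem mul_b (g h : Mdl n) (p) : (g * h).b p = g.b p + g.a p.2 * h.v p.1 + h.b p := rfl
@[simp] theorem mul_c (g h : Mdl n) (q) : (g * h).c q =
    g.c q + g.b (q.2.1, q.1) * h.v q.2.lo + g.b (q.2.lo, q.1) * h.v q.2.1 +
    g.a q.1 * h.v q.2.1 * h.v q.2.lo + h.c q := rfl
@[simp] theorem inv_v (g : Mdl n) : (g⁻¹).v = -g.v := rfl
@[simp] theorem inv_a (g : Mdl n) : (g⁻¹).a = -g.a := rfl
@[simp] theorem inv_b (g : Mdl n) (p) : (g⁻¹).b p = -g.b p + g.a p.2 * g.v p.1 := rfl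
@[simp] theorem inv_c (g : Mdl n) (q) : (g⁻¹).c q =
    -g.c q + g.b (q.2.1, q.1) * g.v q.2.lo + g.b (q.2.lo, q.1) * g.v q.2.1 -
    g.a q.1 * g.v q.2.1 * g.v q.2.lo := rfl

instance : Group (Mdl n) := Group.ofLeftAxioms
  (by intro g h k
      ext q <;> simp <;> ring)
  (by intro g
      ext q <;> simp)
  (by intro g
      ext q <;> simp only [mul_v, mul_a, mul_b, mul_c, inv_v, inv_a, inv_b, inv_c, one_v, one_a,
        one_b, one_c, Pi.add_apply, Pi.neg_apply, Pi.zero_apply] <;> ring)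

theorem comm_of_v {g h : Mdl n} (hg : g.v = 0) (hh : h.v = 0) : Commute g h := by
  change g * h = h * g
  ext q <;> simp [hg, hh] <;> ring

theorem sq_of_v {g : Mdl n} (hg : g.v = 0) : g ^ 2 = 1 := by
  rw [pow_two]
  ext q <;> simp [hg, CharTwo.add_self_eq_zero]

theorem gcomm_v (g h : Mdl n) : (gcomm g h).v = 0 := by
  simp [gcomm]

theorem gcomm_a (g h : Mdl n) : (gcomm g h).a = 0 := by
  simp [gcomm]

theorem gcomm_b {g : Mdl n} (hv : g.v = 0) (ha : g.a = 0) (h : Mdl n) : (gcomm g h).b = 0 := by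
  ext p
  simp only [gcomm, mul_v, mul_a, mul_b, inv_v, inv_a, inv_b, hv, ha, Pi.add_apply, Pi.neg_apply,
    Pi.zero_apply]
  ring

theorem comm_of_b {g : Mdl n} (hv : g.v = 0) (ha : g.a = 0) (hb : g.b = 0) (h : Mdl n) :
    Commute g h := by
  change g * h = h * g
  ext q <;> simp [hv, ha, hb] <;> ring

/-- generators -/
def X (i : Fin n) : Mdl n := ⟨Pi.single i 1, 0, 0, 0⟩
/-- generators -/
def Y (j : Fin n) : Mdl n := ⟨0, Pi.single j 1, 0, 0⟩

theorem exists_map : ∃ f : Hn n →* Mdl n, (∀ i, f (xH i) = X i) ∧ (∀ j, f (yH j) = Y j) := by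
  apply exists_hom
  · intro i
    rw [pow_two]
    ext q <;> simp [X, CharTwo.add_self_eq_zero]
  · intro i; exact sq_of_v rfl
  · intro i j
    change _ * _ = _ * _
    ext q <;> simp [X]
    ring
  · intro i j; exact comm_of_v rfl rfl
  · intro i j; exact sq_of_v (gcomm_v _ _)
  · intro i j k; rw [gcomm_eq_one_iff']; exact comm_of_v (gcomm_v _ _) rfl
  · intro i j k; exact sq_of_v (gcomm_v _ _)
  · intro g₁ g₂ g₃ g₄
    rw [gcomm_eq_one_iff']
    exact comm_of_b (gcomm_v _ _) (gcomm_a _ _) (gcomm_b (gcomm_v _ _) (gcomm_a _ _) _) _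

theorem lo_ne (p : PIdx n) : p.lo ≠ p.1 := by
  intro h
  have := congrArg Fin.val h
  have h2 := p.2.isLt
  simp only [PIdx.lo] at this
  omega

theorem pidx_ext {p q : PIdx n} (h1 : p.1 = q.1) (h2 : p.lo = q.lo) : p = q := by
  obtain ⟨k, l⟩ := p
  obtain ⟨k', l'⟩ := q
  obtain rfl : k = k' := h1
  have := congrArg Fin.val h2
  simp only [PIdx.lo] at this
  rw [Fin.ext this]

theorem yx (i j : Fin n) : Y j * X i = X i * Y j * ⟨0, 0, Pi.single (i, j) 1, 0⟩ := by
  ext q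
  · simp [X, Y]
  · simp [X, Y]
  · simp only [X, Y, mul_b, Pi.zero_apply, Pi.single_apply, Prod.ext_iff, mul_a]
    by_cases h1 : q.1 = i <;> by_cases h2 : q.2 = j <;> simp [h1, h2]
  · have h := lo_ne q.2
    simp only [X, Y, mul_c, Pi.zero_apply, Pi.single_apply]
    by_cases h1 : q.2.1 = i
    · have h2 : q.2.lo ≠ i := fun e => h (e.trans h1.symm)
      simp [h2]
    · simp [h1]

theorem bx (j : Fin n) (p : PIdx n) : (⟨0, 0, Pi.single (p.1, j) 1, 0⟩ : Mdl n) * X p.lo =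
    X p.lo * ⟨0, 0, Pi.single (p.1, j) 1, 0⟩ * ⟨0, 0, 0, Pi.single (j, p) 1⟩ := by
  ext q
  · simp [X]
  · simp [X]
  · simp [X]
  · obtain ⟨j', q⟩ := q
    simp only [X, mul_c, Pi.zero_apply, Pi.single_apply, Prod.ext_iff, mul_a]
    have h0 : ¬ (q.lo = p.1 ∧ q.1 = p.lo) := by
      rintro ⟨h1, h2⟩
      have h1 := congrArg Fin.val h1
      have h2 := congrArg Fin.val h2
      have h3 := q.2.isLt
      have h4 := p.2.isLt
      simp only [PIdx.lo] at h1 h2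
      omega
    have h5 : q = p ↔ q.1 = p.1 ∧ q.lo = p.lo :=
      ⟨fun h => by rw [h]; exact ⟨rfl, rfl⟩, fun h => pidx_ext h.1 h.2⟩
    simp only [h5]
    by_cases e1 : q.1 = p.1 <;> by_cases e2 : q.lo = p.lo <;> by_cases e3 : j' = j <;>
      by_cases e4 : q.lo = p.1 <;> by_cases e5 : q.1 = p.lo <;>
      simp_all

theorem pi_mem {ι : Type*} [Fintype ι] [DecidableEq ι] (S : Subgroup (Mdl n))
    (F : (ι → ZMod 2) → Mdl n) (h0 : F 0 = 1) (hF : ∀ u w, F (u + w) = F u * F w)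
    (hs : ∀ i, F (Pi.single i 1) ∈ S) (u : ι → ZMod 2) : F u ∈ S := by
  let F' : Multiplicative (ι → ZMod 2) →* Mdl n := ⟨⟨fun u => F (Multiplicative.toAdd u), h0⟩,
    fun u w => hF _ _⟩
  have : u ∈ Subgroup.toAddSubgroup' (S.comap F') := by
    apply AddSubgroup.pi_mem_of_single_mem
    intro i
    rcases zmod2 (u i) with h | h <;> rw [h]
    · simp
    · exact hs i
  exact this

theorem mem_all (S : Subgroup (Mdl n)) (hX : ∀ i, X i ∈ S) (hY : ∀ j, Y j ∈ S) (g : Mdl n) :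
    g ∈ S := by
  have hb : ∀ i j, (⟨0, 0, Pi.single (i, j) 1, 0⟩ : Mdl n) ∈ S := by
    intro i j
    have : (⟨0, 0, Pi.single (i, j) 1, 0⟩ : Mdl n) = (X i * Y j)⁻¹ * (Y j * X i) := by
      rw [yx]; group
    rw [this]
    exact mul_mem (inv_mem (mul_mem (hX _) (hY _))) (mul_mem (hY _) (hX _))
  have hc : ∀ j p, (⟨0, 0, 0, Pi.single (j, p) 1⟩ : Mdl n) ∈ S := by
    intro j p
    have : (⟨0, 0, 0, Pi.single (j, p) 1⟩ : Mdl n) =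
      (X p.lo * ⟨0, 0, Pi.single (p.1, j) 1, 0⟩)⁻¹ * (⟨0, 0, Pi.single (p.1, j) 1, 0⟩ * X p.lo) := by
      rw [bx]; group
    rw [this]
    exact mul_mem (inv_mem (mul_mem (hX _) (hb _ _))) (mul_mem (hb _ _) (hX _))
  have e : g = ⟨g.v, 0, 0, 0⟩ * ⟨0, g.a, 0, 0⟩ * ⟨0, 0, g.b, 0⟩ * ⟨0, 0, 0, g.c⟩ := by
    ext q <;> simp
  rw [e]
  refine mul_mem (mul_mem (mul_mem ?_ ?_) ?_) ?_
  · exact pi_mem S (fun v => ⟨v, 0, 0, 0⟩) rfl (fun u w => by ext q <;> simp) hX _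
  · exact pi_mem S (fun v => ⟨0, v, 0, 0⟩) rfl (fun u w => by ext q <;> simp) hY _
  · exact pi_mem S (fun v => ⟨0, 0, v, 0⟩) rfl (fun u w => by ext q <;> simp)
      (fun p => hb p.1 p.2) _
  · exact pi_mem S (fun v => ⟨0, 0, 0, v⟩) rfl (fun u w => by ext q <;> simp)
      (fun p => hc p.1 p.2) _

/-- underlying set of the model -/
def equivProd : Mdl n ≃ (Fin n → ZMod 2) × (TIdx n → ZMod 2) where
  toFun g := (g.v, Sum.elim g.a (Sum.elim g.b g.c))
  invFun p := ⟨p.1, p.2 ∘ Sum.inl, p.2 ∘ Sum.inr ∘ Sum.inl, p.2 ∘ Sum.inr ∘ Sum.inr⟩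
  left_inv g := rfl
  right_inv p := by
    refine Prod.ext rfl ?_
    ext (j | p | p) <;> rfl

end Mdl

variable {n : ℕ}

theorem XT_surj : Surjective (fun p : Multiplicative (Fin n → ZMod 2) ×
    Multiplicative (TIdx n → ZMod 2) => (exists_X_hom (n := n)).choose p.1 *
      (exists_T_hom (n := n)).choose p.2) := by
  intro g
  have h1 := (exists_X_hom (n := n)).choose_spec.2
  have h2 := (exists_T_hom (n := n)).choose_spec
  have : g ∈ XH n ⊔ TH n := by
    apply PresentedGroup.generated_by
    rintro (i | i)
    · exact (le_sup_left : XH n ≤ _) (Subgroup.subset_closure ⟨i, rfl⟩)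
    · exact (le_sup_right : TH n ≤ _) (y_mem_T i)
  rw [Subgroup.mem_sup_of_normal_right] at this
  obtain ⟨x, hx, t, ht, rfl⟩ := this
  rw [← h1] at hx
  rw [← h2] at ht
  obtain ⟨x, rfl⟩ := hx
  obtain ⟨t, rfl⟩ := ht
  exact ⟨(x, t), rfl⟩

instance finite_Hn : Finite (Hn n) := by
  have : Finite (Multiplicative (Fin n → ZMod 2) × Multiplicative (TIdx n → ZMod 2)) :=
    inferInstanceAs (Finite ((Fin n → ZMod 2) × (TIdx n → ZMod 2)))
  exact Finite.of_surjective _ XT_surj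

theorem card_PIdx : Fintype.card (PIdx n) = n * (n - 1) / 2 := by
  rw [Fintype.card_sigma]
  simp only [Fintype.card_fin]
  rw [Fin.sum_univ_eq_sum_range (fun i => i), Finset.sum_range_id]

theorem card_Hn : Nat.card (Hn n) = 2 ^ n * 2 ^ (n + (n * n + n * (n * (n - 1) / 2))) := by
  have hc : Nat.card ((Fin n → ZMod 2) × (TIdx n → ZMod 2)) =
      2 ^ n * 2 ^ (n + (n * n + n * (n * (n - 1) / 2))) := by
    rw [Nat.card_prod, Nat.card_eq_fintype_card, Nat.card_eq_fintype_card, Fintype.card_fun,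
      Fintype.card_fun, ZMod.card, Fintype.card_sum, Fintype.card_sum, Fintype.card_prod,
      Fintype.card_prod, card_PIdx, Fintype.card_fin]
  apply le_antisymm
  · rw [← hc]
    have : Finite (Multiplicative (Fin n → ZMod 2) × Multiplicative (TIdx n → ZMod 2)) :=
      inferInstanceAs (Finite ((Fin n → ZMod 2) × (TIdx n → ZMod 2)))
    exact Nat.card_le_card_of_surjective _ (XT_surj (n := n))
  · rw [← hc, ← Nat.card_congr (Mdl.equivProd (n := n))]
    obtain ⟨f, fx, fy⟩ := Mdl.exists_map (n := n)
    apply Nat.card_le_card_of_surjective f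
    intro g
    exact Mdl.mem_all f.range (fun i => ⟨_, fx i⟩) (fun i => ⟨_, fy i⟩) g

theorem exp_eq : n * n + n * (n * (n - 1) / 2) = n ^ 2 * (n + 1) / 2 := by
  have h : 2 ∣ n * (n - 1) := by
    rcases n with _ | m
    · simp
    · rw [Nat.add_sub_cancel, mul_comm]; exact (Nat.even_mul_succ_self m).two_dvd
  obtain ⟨k, hk⟩ := h
  rw [hk, Nat.mul_div_cancel_left _ (by norm_num : 0 < 2)]
  have : n ^ 2 * (n + 1) = 2 * (n * n + n * k) := by
    rcases n with _ | m
    · simp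
    · rw [Nat.add_sub_cancel] at hk
      calc (m + 1) ^ 2 * (m + 1 + 1) = 2 * ((m + 1) * (m + 1)) + (m + 1) * ((m + 1) * m) := by ring
        _ = _ := by rw [hk]; ring
  rw [this, Nat.mul_div_cancel_left _ (by norm_num : 0 < 2)]

theorem card_SigmaV (hn : 0 < n) : Nat.card (SigmaV n) = 2 ^ (n ^ 2 * (n + 1) / 2 + n + 1) := by
  rw [card_V hn]
  have h1 := (XH n).card_mul_index
  have h2 := (YH n).card_mul_index
  rw [card_X, card_Hn] at h1
  rw [card_Y, card_Hn] at h2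
  have p : 0 < 2 ^ n := by positivity
  rw [Nat.eq_of_mul_eq_mul_left p h1, Nat.eq_of_mul_eq_mul_left p h2, exp_eq]
  ring

end Model

/-- `Σ(H(n),X,Y)` has `2^{n²(n+1)/2 + n + 1}` vertices and is locally 2-arc-transitive:
for every vertex `u`, the stabiliser of `u` in `Aut(Σ)` is transitive on the 2-arcs starting
at `u`. -/
theorem statement2 (n : ℕ) (hn : 2 ≤ n) :
    Nat.card (SigmaV n) = 2 ^ (n ^ 2 * (n + 1) / 2 + n + 1) ∧
    (∀ u v w v' w' : SigmaV n,
      (SigmaGraph n).Adj u v → (SigmaGraph n).Adj v w → u ≠ w →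
      (SigmaGraph n).Adj u v' → (SigmaGraph n).Adj v' w' → u ≠ w' →
      ∃ φ : SigmaGraph n ≃g SigmaGraph n, φ u = u ∧ φ v = v' ∧ φ w = w') := by
  exact ⟨card_SigmaV (by omega), local_trans (by omega)⟩
end

section
/- Let n ≥ 2, let F be the free group on a_1,…,a_{2n}, let K be defined as above, and let I be the subgroup of F generated by K together with all elements [a,a'], [b,b'], [[a,a'],c], [[b,b'],c], [[b,a],b'] for a,a' ∈ A_0, b,b' ∈ B_0, c ∈ A_0 ∪ B_0. Then K is properly contained in I, I ≤ F'I = F'K, I is a normal subgroup of F, and (F/I)/(F/I)' ≅ F/F'I is elementary abelian of order 2^{2n}. -/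
/-- The free group `F` on `2n` generators `a_1, …, a_{2n}`; the index set is split as
`Fin n ⊕ Fin n`, where `Sum.inl i` indexes the generators in `A_0 = {a_1,…,a_n}` and
`Sum.inr i` indexes those in `B_0 = {a_{n+1},…,a_{2n}}`. -/
abbrev F2 (n : ℕ) := FreeGroup (Fin n ⊕ Fin n)

/-- A generator of `F` from `A_0`. -/
abbrev aA {n : ℕ} (i : Fin n) : F2 n := FreeGroup.of (Sum.inl i)

/-- A generator of `F` from `B_0`. -/
abbrev aB {n : ℕ} (i : Fin n) : F2 n := FreeGroup.of (Sum.inr i)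

/-- An arbitrary generator of `F`. -/
abbrev aZ {n : ℕ} (z : Fin n ⊕ Fin n) : F2 n := FreeGroup.of z

/-- The subgroup `K` of `F`: generated by `F_4` together with all `a_i²`, `[a_i,a_j]²`,
`[[a_i,a_j],a_k]²` and `[[a_i,a_j],a_i]` for `i,j,k ∈ {1,…,2n}` (Mathlib's
`lowerCentralSeries F 3` is `F_4`). -/
def K2 (n : ℕ) : Subgroup (F2 n) :=
  Subgroup.closure
    ((Subgroup.lowerCentralSeries (⊤ : Subgroup (F2 n)) 3 : Set (F2 n)) ∪
      ({w | ∃ z, w = aZ z ^ 2} ∪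
       {w | ∃ z z', w = gcomm (aZ (n := n) z) (aZ z') ^ 2} ∪
       {w | ∃ z z' z'', w = gcomm (gcomm (aZ (n := n) z) (aZ z')) (aZ z'') ^ 2} ∪
       {w | ∃ z z', w = gcomm (gcomm (aZ (n := n) z) (aZ z')) (aZ z)}))

/-- The subgroup `I` of `F`: generated by `K` together with all `[a,a']`, `[b,b']`,
`[[a,a'],c]`, `[[b,b'],c]`, `[[b,a],b']` for `a,a' ∈ A_0`, `b,b' ∈ B_0`,
`c ∈ A_0 ∪ B_0`. -/
def I2 (n : ℕ) : Subgroup (F2 n) :=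
  Subgroup.closure
    ((K2 n : Set (F2 n)) ∪
      ({w | ∃ i j : Fin n, w = gcomm (aA i) (aA j)} ∪
       {w | ∃ i j : Fin n, w = gcomm (aB i) (aB j)} ∪
       {w | ∃ (i j : Fin n) (z : Fin n ⊕ Fin n), w = gcomm (gcomm (aA i) (aA j)) (aZ z)} ∪
       {w | ∃ (i j : Fin n) (z : Fin n ⊕ Fin n), w = gcomm (gcomm (aB i) (aB j)) (aZ z)} ∪
       {w | ∃ (i j : Fin n) (k : Fin n), w = gcomm (gcomm (aB i) (aA k)) (aB j)}))

open scoped commutatorElement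

lemma gcomm_eq {G : Type*} [Group G] (g h : G) : gcomm g h = ⁅g⁻¹, h⁻¹⁆ := by
  simp [gcomm, commutatorElement_def]

lemma gcomm_mem_lcs {G : Type*} [Group G] {k : ℕ} {g : G} (h : G)
    (hg : g ∈ Subgroup.lowerCentralSeries (⊤ : Subgroup G) k) :
    gcomm g h ∈ Subgroup.lowerCentralSeries (⊤ : Subgroup G) (k + 1) := by
  rw [gcomm_eq, Subgroup.lowerCentralSeries_succ]
  exact Subgroup.commutator_mem_commutator (inv_mem hg) (Subgroup.mem_top _)

lemma conj_eq_mul_gcomm {G : Type*} [Group G] (g h : G) : h⁻¹ * g * h = g * gcomm g h := by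
  simp only [gcomm]; group

/-- Normality criterion for a closure in a free group when squares of generators are present. -/
lemma normal_closure_aux {ι : Type*} (S : Set (FreeGroup ι))
    (h2 : ∀ z, (FreeGroup.of z) ^ 2 ∈ Subgroup.closure S)
    (h : ∀ s ∈ S, ∀ z, (FreeGroup.of z)⁻¹ * s * FreeGroup.of z ∈ Subgroup.closure S) :
    (Subgroup.closure S).Normal := by
  set N := Subgroup.closure S with hN
  have h1 : ∀ z, ∀ w ∈ N, (FreeGroup.of z)⁻¹ * w * FreeGroup.of z ∈ N := by
    intro z w hw
    have hle : N ≤ N.comap (MulAut.conj (FreeGroup.of z)⁻¹).toMonoidHom := by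
      rw [hN, Subgroup.closure_le]
      intro s hs
      simpa using h s hs z
    simpa using hle hw
  have h1' : ∀ z, ∀ w ∈ N, (FreeGroup.of z) * w * (FreeGroup.of z)⁻¹ ∈ N := by
    intro z w hw
    have e : (FreeGroup.of z) * w * (FreeGroup.of z)⁻¹ =
        (FreeGroup.of z) ^ 2 * ((FreeGroup.of z)⁻¹ * w * FreeGroup.of z) *
          ((FreeGroup.of z) ^ 2)⁻¹ := by group
    rw [e]
    exact mul_mem (mul_mem (h2 z) (h1 z w hw)) (inv_mem (h2 z))
  refine ⟨fun w hw g => ?_⟩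
  induction g using FreeGroup.induction_on generalizing w with
  | C1 => simpa using hw
  | of z => exact h1' z w hw
  | inv_of z _ => simpa using h1 z w hw
  | mul x y hx hy =>
    have e : x * y * w * (x * y)⁻¹ = x * (y * w * y⁻¹) * x⁻¹ := by group
    rw [e]
    exact hx _ (hy _ hw)

lemma lcs_le_K (n : ℕ) : Subgroup.lowerCentralSeries (⊤ : Subgroup (F2 n)) 3 ≤ K2 n :=
  fun _ hw => Subgroup.subset_closure (Or.inl hw)

lemma sq_mem_K {n : ℕ} (z : Fin n ⊕ Fin n) : aZ z ^ 2 ∈ K2 n :=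
  Subgroup.subset_closure (Or.inr (Or.inl (Or.inl (Or.inl ⟨z, rfl⟩))))

lemma csq_mem_K {n : ℕ} (z z' : Fin n ⊕ Fin n) : gcomm (aZ z) (aZ z') ^ 2 ∈ K2 n :=
  Subgroup.subset_closure (Or.inr (Or.inl (Or.inl (Or.inr ⟨z, z', rfl⟩))))

lemma ccsq_mem_K {n : ℕ} (z z' z'' : Fin n ⊕ Fin n) :
    gcomm (gcomm (aZ z) (aZ z')) (aZ z'') ^ 2 ∈ K2 n :=
  Subgroup.subset_closure (Or.inr (Or.inl (Or.inr ⟨z, z', z'', rfl⟩)))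

lemma cc_mem_K {n : ℕ} (z z' : Fin n ⊕ Fin n) :
    gcomm (gcomm (aZ z) (aZ z')) (aZ z) ∈ K2 n :=
  Subgroup.subset_closure (Or.inr (Or.inr ⟨z, z', rfl⟩))

lemma gcomm_cc_mem_K {n : ℕ} (x y z w : F2 n) :
    gcomm (gcomm (gcomm x y) z) w ∈ Subgroup.lowerCentralSeries (⊤ : Subgroup (F2 n)) 3 :=
  gcomm_mem_lcs (k := 2) _ (gcomm_mem_lcs (k := 1) _
    (gcomm_mem_lcs (k := 0) _ (by simp [Subgroup.lowerCentralSeries_zero])))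

lemma K_normal (n : ℕ) : (K2 n).Normal := by
  apply normal_closure_aux
  · intro z; exact sq_mem_K z
  · rintro s (hs | ((⟨z, rfl⟩ | ⟨z, z', rfl⟩) | ⟨z, z', z'', rfl⟩) | ⟨z, z', rfl⟩) x
    · refine lcs_le_K n ?_
      have := (inferInstance :
        (Subgroup.lowerCentralSeries (⊤ : Subgroup (F2 n)) 3).Normal).conj_mem s hs (aZ x)⁻¹
      simpa using this
    · change _ ∈ K2 n
      set a := aZ z
      set c := gcomm a (aZ x) with hc
      have e : (aZ x)⁻¹ * a ^ 2 * aZ x = a ^ 2 * c ^ 2 * (gcomm c a * gcomm (gcomm c a) c) := by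
        simp only [hc, gcomm, pow_two]; group
      change (aZ x)⁻¹ * a ^ 2 * aZ x ∈ K2 n
      rw [e]
      exact mul_mem (mul_mem (sq_mem_K z) (csq_mem_K z x))
        (mul_mem (cc_mem_K z x) (lcs_le_K n (gcomm_cc_mem_K _ _ _ _)))
    · change (aZ x)⁻¹ * _ * aZ x ∈ K2 n
      set c := gcomm (aZ z) (aZ z') with hc
      set d := gcomm c (aZ x) with hd
      have e : (aZ x)⁻¹ * c ^ 2 * aZ x = c ^ 2 * d ^ 2 * (d⁻¹ * gcomm d c * d⁻¹⁻¹) := by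
        simp only [hd, gcomm, pow_two]; group
      rw [e]
      exact mul_mem (mul_mem (csq_mem_K z z') (ccsq_mem_K z z' x))
        (lcs_le_K n (Subgroup.Normal.conj_mem inferInstance _ (gcomm_cc_mem_K _ _ _ _) _))
    · change (aZ x)⁻¹ * _ * aZ x ∈ K2 n
      set c := gcomm (gcomm (aZ z) (aZ z')) (aZ z'') with hc
      have e : (aZ x)⁻¹ * c ^ 2 * aZ x =
          c ^ 2 * (c⁻¹ * gcomm c (aZ x) * c⁻¹⁻¹ * gcomm c (aZ x)) := by
        simp only [gcomm, pow_two]; group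
      rw [e]
      have h4 : gcomm c (aZ x) ∈ Subgroup.lowerCentralSeries (⊤ : Subgroup (F2 n)) 3 :=
        gcomm_cc_mem_K _ _ _ _
      exact mul_mem (ccsq_mem_K z z' z'')
        (lcs_le_K n (mul_mem (Subgroup.Normal.conj_mem inferInstance _ h4 _) h4))
    · change (aZ x)⁻¹ * _ * aZ x ∈ K2 n
      rw [conj_eq_mul_gcomm]
      exact mul_mem (cc_mem_K _ _) (lcs_le_K n (gcomm_cc_mem_K _ _ _ _))

lemma K_le_I (n : ℕ) : K2 n ≤ I2 n := fun _ hw => Subgroup.subset_closure (Or.inl hw)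

lemma I_normal (n : ℕ) : (I2 n).Normal := by
  have key : ∀ x y z w : F2 n, gcomm (gcomm (gcomm x y) z) w ∈ I2 n := fun x y z w =>
    K_le_I n (lcs_le_K n (gcomm_cc_mem_K _ _ _ _))
  apply normal_closure_aux
  · intro z; exact K_le_I n (sq_mem_K z)
  · intro s hs x
    change _ ∈ I2 n
    rcases id hs with hk | hs'
    · apply K_le_I
      simpa using (K_normal n).conj_mem s hk (aZ x)⁻¹
    · rw [conj_eq_mul_gcomm]
      refine mul_mem (Subgroup.subset_closure hs) ?_
      rcases hs' with (((⟨i, j, rfl⟩ | ⟨i, j, rfl⟩) | ⟨i, j, z, rfl⟩) | ⟨i, j, z, rfl⟩) | ⟨i, j, k, rfl⟩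
      · exact Subgroup.subset_closure
          (Or.inr (Or.inl (Or.inl (Or.inr ⟨i, j, x, rfl⟩))))
      · exact Subgroup.subset_closure (Or.inr (Or.inl (Or.inr ⟨i, j, x, rfl⟩)))
      all_goals exact key _ _ _ _

lemma gcomm_mem_commutator {G : Type*} [Group G] (g h : G) : gcomm g h ∈ commutator G := by
  rw [gcomm_eq]
  exact Subgroup.commutator_mem_commutator (Subgroup.mem_top g⁻¹) (Subgroup.mem_top h⁻¹)

lemma sup_eq (n : ℕ) : commutator (F2 n) ⊔ I2 n = commutator (F2 n) ⊔ K2 n := by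
  apply le_antisymm
  · refine sup_le le_sup_left ?_
    rw [I2, Subgroup.closure_le]
    rintro s (hk | hs')
    · exact (le_sup_right : K2 n ≤ _) hk
    · refine (le_sup_left : commutator (F2 n) ≤ _) ?_
      rcases hs' with (((⟨i, j, rfl⟩ | ⟨i, j, rfl⟩) | ⟨i, j, z, rfl⟩) | ⟨i, j, z, rfl⟩) | ⟨i, j, k, rfl⟩
      all_goals exact gcomm_mem_commutator _ _
  · exact sup_le_sup_left (K_le_I n) _

/-! A homomorphism to the dihedral group of order 8 separating `K` from `I`. -/

lemma d4_sq (x y : DihedralGroup 4) : gcomm x y ^ 2 = 1 := by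
  revert x y; unfold gcomm; decide

lemma d4_cc (x y z : DihedralGroup 4) : ⁅⁅x, y⁆, z⁆ = 1 := by
  revert x y z; simp only [commutatorElement_def]; decide

lemma d4_gcc (x y z : DihedralGroup 4) : gcomm (gcomm x y) z = 1 := by
  revert x y z; simp only [gcomm]; decide

lemma lcs_d4 : Subgroup.lowerCentralSeries (⊤ : Subgroup (DihedralGroup 4)) 3 = ⊥ := by
  have h2 : Subgroup.lowerCentralSeries (⊤ : Subgroup (DihedralGroup 4)) 2 = ⊥ := by
    rw [Subgroup.lowerCentralSeries_succ, Subgroup.top_lowerCentralSeries_one,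
      Subgroup.commutator_top_right_eq_bot_iff_le_center, commutator_def, Subgroup.commutator_le]
    intro x _ y _
    rw [Subgroup.mem_center_iff]
    intro z
    exact (commutatorElement_eq_one_iff_mul_comm.mp (d4_cc x y z)).symm
  rw [eq_bot_iff, ← h2]
  exact Subgroup.lowerCentralSeries_antitone _ (by norm_num)

lemma K_lt_I (n : ℕ) (hn : 2 ≤ n) : K2 n < I2 n := by
  refine lt_of_le_of_ne (K_le_I n) fun hEq => ?_
  let i0 : Fin n := ⟨0, by omega⟩
  let i1 : Fin n := ⟨1, by omega⟩
  let v : Fin n ⊕ Fin n → DihedralGroup 4 := fun z =>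
    if z = Sum.inl i0 then DihedralGroup.sr 0 else
      if z = Sum.inl i1 then DihedralGroup.sr 1 else 1
  have hv : ∀ z, v z ^ 2 = 1 := by
    intro z
    simp only [v]
    split_ifs <;> decide
  let f : F2 n →* DihedralGroup 4 := FreeGroup.lift v
  have hf : ∀ x y, f (gcomm x y) = gcomm (f x) (f y) := by
    intro x y; simp [gcomm]
  have hK : K2 n ≤ f.ker := by
    rw [K2, Subgroup.closure_le]
    rintro s (hs | ((⟨z, rfl⟩ | ⟨z, z', rfl⟩) | ⟨z, z', z'', rfl⟩) | ⟨z, z', rfl⟩)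
    · have h1 : f s ∈ (Subgroup.lowerCentralSeries (⊤ : Subgroup (F2 n)) 3).map f :=
        Subgroup.mem_map_of_mem f hs
      have h3 : ∀ k, (Subgroup.lowerCentralSeries (⊤ : Subgroup (F2 n)) k).map f ≤
          Subgroup.lowerCentralSeries (⊤ : Subgroup (DihedralGroup 4)) k := by
        intro k
        induction k with
        | zero => exact le_top
        | succ k ih =>
          rw [Subgroup.lowerCentralSeries_succ, Subgroup.lowerCentralSeries_succ,
            Subgroup.map_commutator]
          exact Subgroup.commutator_mono ih le_top
      have h2 := h3 3 h1
      rw [lcs_d4] at h2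
      exact h2
    · change f _ = 1
      simpa [f] using hv z
    · change f _ = 1
      rw [map_pow, hf, d4_sq]
    · change f _ = 1
      rw [map_pow, hf, d4_sq]
    · change f _ = 1
      rw [hf, hf, d4_gcc]
  have hI : gcomm (aA i0) (aA i1) ∈ I2 n :=
    Subgroup.subset_closure (Or.inr (Or.inl (Or.inl (Or.inl (Or.inl ⟨i0, i1, rfl⟩)))))
  rw [← hEq] at hI
  have h1 : f (gcomm (aA i0) (aA i1)) = 1 := hK hI
  have h01 : i1 ≠ i0 := by simp [i0, i1]
  rw [hf] at h1
  simp only [f, aA, FreeGroup.lift_apply_of, v, Sum.inl.injEq, if_true, h01, if_false] at h1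
  revert h1
  unfold gcomm
  decide

/-! The index. -/

/-- The exponent map modulo 2. -/
def expMap (n : ℕ) : F2 n →* Multiplicative ((Fin n ⊕ Fin n) → ZMod 2) :=
  FreeGroup.lift fun z => Multiplicative.ofAdd (Pi.single z 1)

lemma expMap_sq {n : ℕ} (g : Multiplicative ((Fin n ⊕ Fin n) → ZMod 2)) : g ^ 2 = 1 := by
  apply Multiplicative.toAdd.injective
  funext i
  simp only [toAdd_pow, toAdd_one, Pi.smul_apply, Pi.zero_apply]
  generalize Multiplicative.toAdd g i = t
  revert t; decide

lemma expMap_gcomm {n : ℕ} (x y : F2 n) : expMap n (gcomm x y) = 1 := by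
  simp only [gcomm, map_mul, map_inv]
  rw [mul_right_comm, inv_mul_cancel_right, inv_mul_cancel]

lemma sup_le_ker (n : ℕ) : commutator (F2 n) ⊔ K2 n ≤ (expMap n).ker := by
  have hc : commutator (F2 n) ≤ (expMap n).ker := Abelianization.commutator_subset_ker _
  refine sup_le hc ?_
  rw [K2, Subgroup.closure_le]
  rintro s (hs | ((⟨z, rfl⟩ | ⟨z, z', rfl⟩) | ⟨z, z', z'', rfl⟩) | ⟨z, z', rfl⟩)
  · apply hc
    rw [← Subgroup.top_lowerCentralSeries_one]
    exact Subgroup.lowerCentralSeries_antitone _ (by norm_num) hs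
  · change expMap n _ = 1
    rw [map_pow, expMap_sq]
  · change expMap n _ = 1
    rw [map_pow, expMap_sq]
  · change expMap n _ = 1
    rw [map_pow, expMap_sq]
  · exact hc (gcomm_mem_commutator _ _)

lemma sq_mem_sup {n : ℕ} (g : F2 n) : g * g ∈ commutator (F2 n) ⊔ K2 n := by
  set N := commutator (F2 n) ⊔ K2 n with hN
  have hc : ∀ x y, gcomm x y ∈ N := fun x y =>
    (le_sup_left : commutator (F2 n) ≤ _) (gcomm_mem_commutator x y)
  induction g using FreeGroup.induction_on with
  | C1 => simp
  | of z =>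
    rw [← pow_two]
    exact (le_sup_right : K2 n ≤ _) (sq_mem_K z)
  | inv_of z h => simpa using inv_mem h
  | mul x y hx hy =>
    have e : x * y * (x * y) = (x * x) * gcomm x y⁻¹ * (y * y) := by
      simp only [gcomm]; group
    rw [e]
    exact mul_mem (mul_mem hx (hc _ _)) hy

lemma ker_le_sup (n : ℕ) : (expMap n).ker ≤ commutator (F2 n) ⊔ K2 n := by
  have : (K2 n).Normal := K_normal n
  set N := commutator (F2 n) ⊔ K2 n with hN
  have hNn : N.Normal := inferInstance
  have hc : ∀ x y, gcomm x y ∈ N := fun x y =>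
    (le_sup_left : commutator (F2 n) ≤ _) (gcomm_mem_commutator x y)
  let _ : CommGroup (F2 n ⧸ N) :=
    { (inferInstance : Group (F2 n ⧸ N)) with
      mul_comm := by
        intro x y
        induction x using QuotientGroup.induction_on with | _ x
        induction y using QuotientGroup.induction_on with | _ y
        rw [← QuotientGroup.mk_mul, ← QuotientGroup.mk_mul, QuotientGroup.eq]
        have e : (x * y)⁻¹ * (y * x) = gcomm y x := by simp only [gcomm]; group
        rw [e]
        exact hc _ _ }
  let _ : Module (ZMod 2) (Additive (F2 n ⧸ N)) := AddCommGroup.zmodModule (by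
    intro x
    apply Additive.toMul.injective
    rw [toMul_nsmul, toMul_zero]
    generalize Additive.toMul x = y
    induction y using QuotientGroup.induction_on with | _ y
    rw [← QuotientGroup.mk_pow, QuotientGroup.eq_one_iff, pow_two]
    exact sq_mem_sup y)
  let L : ((Fin n ⊕ Fin n) → ZMod 2) →ₗ[ZMod 2] Additive (F2 n ⧸ N) :=
    Fintype.linearCombination (ZMod 2)
      fun z => Additive.ofMul (QuotientGroup.mk (s := N) (FreeGroup.of z))
  let ψ : Multiplicative ((Fin n ⊕ Fin n) → ZMod 2) →* (F2 n ⧸ N) :=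
    AddMonoidHom.toMultiplicativeLeft L.toAddMonoidHom
  have hcomp : ψ.comp (expMap n) = QuotientGroup.mk' N := by
    apply FreeGroup.ext_hom
    intro z
    change (L (Multiplicative.toAdd (expMap n (FreeGroup.of z)))).toMul = _
    simp only [expMap, FreeGroup.lift_apply_of, toAdd_ofAdd, L,
      Fintype.linearCombination_apply_single, one_smul]
    rfl
  intro g hg
  have h1 : QuotientGroup.mk' N g = 1 := by
    rw [← hcomp, MonoidHom.comp_apply, MonoidHom.mem_ker.mp hg, map_one]
  exact (QuotientGroup.eq_one_iff g).mp h1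

lemma expMap_surjective (n : ℕ) : Function.Surjective (expMap n) := by
  intro v
  have h : ∀ w : (Fin n ⊕ Fin n) → ZMod 2, Multiplicative.ofAdd w ∈ (expMap n).range := by
    intro w
    rw [← Finset.univ_sum_single w, ofAdd_sum]
    refine Subgroup.prod_mem _ fun z _ => ?_
    refine ⟨FreeGroup.of z ^ (w z).val, ?_⟩
    rw [map_pow, expMap, FreeGroup.lift_apply_of, ← ofAdd_nsmul, ← Pi.single_smul]
    simp
  exact h (Multiplicative.toAdd v)

lemma sup_index (n : ℕ) : (commutator (F2 n) ⊔ K2 n).index = 2 ^ (2 * n) := by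
  rw [le_antisymm (sup_le_ker n) (ker_le_sup n), Subgroup.index_ker,
    MonoidHom.range_eq_top.mpr (expMap_surjective n), Subgroup.card_top]
  change Nat.card ((Fin n ⊕ Fin n) → ZMod 2) = _
  simp [two_mul]

/-- `K < I ≤ F'I = F'K`, `I` is normal in `F`, and `(F/I)/(F/I)' ≅ F/F'I` is elementary
abelian of order `2^{2n}` (the latter expressed quotient-freely: `[F : F'I] = 2^{2n}` and all
squares and commutators lie in `F'I`). -/
theorem statement10 (n : ℕ) (hn : 2 ≤ n) :
    K2 n < I2 n ∧
    I2 n ≤ commutator (F2 n) ⊔ I2 n ∧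
    commutator (F2 n) ⊔ I2 n = commutator (F2 n) ⊔ K2 n ∧
    (I2 n).Normal ∧
    (commutator (F2 n) ⊔ I2 n).index = 2 ^ (2 * n) ∧
    (∀ g : F2 n, g * g ∈ commutator (F2 n) ⊔ I2 n) ∧
    (∀ g h : F2 n, gcomm g h ∈ commutator (F2 n) ⊔ I2 n) := by
  refine ⟨K_lt_I n hn, le_sup_right, sup_eq n, I_normal n, ?_, ?_, ?_⟩
  · rw [sup_eq, sup_index]
  · intro g
    rw [sup_eq]
    exact sq_mem_sup g
  · intro g h
    exact (le_sup_left : commutator (F2 n) ≤ _) (gcomm_mem_commutator g h)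
end
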